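/- For every n ≥ 2, the distribution ratios F and G_2 on SG(n) agree at almost all vertices: F(n,x) = G_2(n,x) for every vertex x of SG(n) other than o, a_n, b_n and the three vertices a* = (2^{n-1}, (2^{n-1}−1)√3), b* = (2^{n-1}−1/2, (2^n−1)√3/2), c* = (2^{n-1}+1/2, (2^n−1)√3/2) (the corners of the smallest lacunary triangle adjacent to b_n). At the exceptional vertices: F(n,a*) = 5/12 and G_2(n,a*) = 5/18 for all n ≥ 2; F(n,b*) = 5/12 and G_2(n,b*) = 5/18 for odd n, while F(n,b*) = 1/6 and G_2(n,b*) = 7/18 for even n; F(n,c*) = 1/6 and G_2(n,c*) = 7/18 for odd n, while F(n,c*) = 5/12 and G_2(n,c*) = 5/18 for even n. -/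

import Mathlib

open scoped Classical
open Filter Topology

noncomputable section

namespace SierpinskiGasket

/-- √3 -/
def sq3 : ℝ := Real.sqrt 3

/-- the origin, leftmost outmost vertex of every `SG n` -/
def o : ℝ × ℝ := (0, 0)

/-- `a m = (2^m, 0)`, the rightmost vertex of `SG m` (also a translation vector). -/
def a (m : ℕ) : ℝ × ℝ := ((2:ℝ) ^ m, 0)

/-- `b m = (2^(m-1), 2^(m-1)·√3)`, the topmost vertex of `SG m`. -/
def b (m : ℕ) : ℝ × ℝ := ((2:ℝ) ^ m / 2, (2:ℝ) ^ m / 2 * sq3)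

/-- `c m = (3·2^(m-1), 2^(m-1)·√3)`. -/
def c (m : ℕ) : ℝ × ℝ := (3 * (2:ℝ) ^ m / 2, (2:ℝ) ^ m / 2 * sq3)

/-- vertex set of `SG n` -/
def V : ℕ → Set (ℝ × ℝ)
  | 0 => {o, a 0, b 0}
  | n + 1 => V n ∪ ((· + a n) '' V n) ∪ ((· + b n) '' V n)

/-- edge set of `SG n` -/
def E : ℕ → Set (Sym2 (ℝ × ℝ))
  | 0 => {s(o, a 0), s(o, b 0), s(a 0, b 0)}
  | n + 1 => E n ∪ (Sym2.map (· + a n) '' E n) ∪ (Sym2.map (· + b n) '' E n)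

/-- `SG n` as a simple graph on `ℝ × ℝ` -/
def G (n : ℕ) : SimpleGraph (ℝ × ℝ) := SimpleGraph.fromEdgeSet (E n)

/-- a Hamiltonian path of `SG n`: a path visiting every vertex of `SG n` exactly once -/
def IsHamPath (n : ℕ) {u v : ℝ × ℝ} (p : (G n).Walk u v) : Prop :=
  p.IsPath ∧ ∀ x, x ∈ p.support ↔ x ∈ V n

/-- a Hamiltonian cycle of `SG n` -/
def IsHamCycle (n : ℕ) {u : ℝ × ℝ} (p : (G n).Walk u u) : Prop :=
  p.IsCycle ∧ ∀ x, x ∈ p.support ↔ x ∈ V n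

/-- `f n u v`: the number of Hamiltonian paths of `SG n` with end-vertex set `{u, v}`
(for `u ≠ v`, such unordered paths correspond bijectively to walks from `u` to `v`). -/
def f (n : ℕ) (u v : ℝ × ℝ) : ℕ := Nat.card {p : (G n).Walk u v // IsHamPath n p}

/-- `f1 n`: the number of Hamiltonian paths of `SG n` with end-vertex set `{o, a n}` -/
def f1 (n : ℕ) : ℕ := f n o (a n)

/-- the number of Hamiltonian cycles of `SG n`, counted up to starting vertex and
orientation: every Hamiltonian cycle passes through `o` and has exactly two
representatives as a closed walk based at `o`. -/
def HC (n : ℕ) : ℕ := Nat.card {p : (G n).Walk o o // IsHamCycle n p} / 2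

/-- the number of Hamiltonian paths of `SG n` having `o` as one of their end vertices -/
def H0 (n : ℕ) : ℕ := ∑ᶠ x ∈ {x : ℝ × ℝ | x ≠ o}, f n o x

/-- the total number of Hamiltonian paths of `SG n` (a path and its reversal
are the same unordered object, whence the division by `2`). -/
def H (n : ℕ) : ℕ := (∑ᶠ u : ℝ × ℝ, ∑ᶠ v : ℝ × ℝ, f n u v) / 2

/-- the distribution ratio `F(n,x) = f(n,x)/f1(n)` -/
def F (n : ℕ) (x : ℝ × ℝ) : ℝ := (f n o x : ℝ) / (f1 n : ℝ)

/-- `SG n` with the vertex `b n` (and its incident edges) deleted -/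
def Gd (n : ℕ) : SimpleGraph (ℝ × ℝ) := SimpleGraph.fromEdgeSet {e ∈ E n | b n ∉ e}

/-- Hamiltonian path of `SG n - b n` -/
def IsHamPathD (n : ℕ) {u v : ℝ × ℝ} (p : (Gd n).Walk u v) : Prop :=
  p.IsPath ∧ ∀ x, x ∈ p.support ↔ (x ∈ V n ∧ x ≠ b n)

/-- `g2 n x`: the number of Hamiltonian paths of `SG n - b n` with end-vertex set `{o, x}` -/
def g2 (n : ℕ) (x : ℝ × ℝ) : ℕ := Nat.card {p : (Gd n).Walk o x // IsHamPathD n p}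

/-- `g1 n`: the number of Hamiltonian paths of `SG n - b n` with end-vertex set `{o, a n}` -/
def g1 (n : ℕ) : ℕ := g2 n (a n)

/-- the distribution ratio `G₂(n,x) = g₂(n,x)/g₁(n)` -/
def G2 (n : ℕ) (x : ℝ × ℝ) : ℝ := (g2 n x : ℝ) / (g1 n : ℝ)

/-- mid-side vertex `a_{m,1} = (3·2^(m-1), 0)` -/
def a1 (m : ℕ) : ℝ × ℝ := (3 * (2:ℝ) ^ m / 2, 0)

/-- mid-side vertex `b_{m,1} = (5·2^(m-2), 2^(m-2)·√3)` -/
def b1 (m : ℕ) : ℝ × ℝ := (5 * (2:ℝ) ^ m / 4, (2:ℝ) ^ m / 4 * sq3)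

/-- mid-side vertex `c_{m,1} = (7·2^(m-2), 2^(m-2)·√3)` -/
def c1 (m : ℕ) : ℝ × ℝ := (7 * (2:ℝ) ^ m / 4, (2:ℝ) ^ m / 4 * sq3)

/-- mid-side vertex `a_{m,2} = (2^m, 2^(m-1)·√3)` -/
def a2 (m : ℕ) : ℝ × ℝ := ((2:ℝ) ^ m, (2:ℝ) ^ m / 2 * sq3)

/-- mid-side vertex `b_{m,2} = (3·2^(m-2), 3·2^(m-2)·√3)` -/
def b2 (m : ℕ) : ℝ × ℝ := (3 * (2:ℝ) ^ m / 4, 3 * (2:ℝ) ^ m / 4 * sq3)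

/-- mid-side vertex `c_{m,2} = (5·2^(m-2), 3·2^(m-2)·√3)` -/
def c2 (m : ℕ) : ℝ × ℝ := (5 * (2:ℝ) ^ m / 4, 3 * (2:ℝ) ^ m / 4 * sq3)

/-- exceptional vertex `a* = (2^(n-1), (2^(n-1)-1)·√3)` -/
def astar (n : ℕ) : ℝ × ℝ := ((2:ℝ) ^ n / 2, ((2:ℝ) ^ n / 2 - 1) * sq3)

/-- exceptional vertex `b* = (2^(n-1) - 1/2, (2^n-1)·√3/2)` -/
def bstar (n : ℕ) : ℝ × ℝ := ((2:ℝ) ^ n / 2 - 1/2, ((2:ℝ) ^ n - 1) * sq3 / 2)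

/-- exceptional vertex `c* = (2^(n-1) + 1/2, (2^n-1)·√3/2)` -/
def cstar (n : ℕ) : ℝ × ℝ := ((2:ℝ) ^ n / 2 + 1/2, ((2:ℝ) ^ n - 1) * sq3 / 2)

/-- the Euclidean norm on `ℝ × ℝ` -/
def enorm (x : ℝ × ℝ) : ℝ := Real.sqrt (x.1 ^ 2 + x.2 ^ 2)

/-- the set `C n` of corner vertices of `SG n` -/
def C (n : ℕ) : Finset (ℝ × ℝ) :=
  ((Finset.range (n + 1)).image a) ∪ ((Finset.range (n + 1)).image b) ∪
    ((Finset.range n).image c)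

/-- the mean `ℓ` displacement over the corner vertices -/
def xi' (n : ℕ) (ℓ : ℝ) : ℝ :=
  (∑ x ∈ C n, enorm x ^ ℓ * F n x) / (∑ x ∈ C n, F n x)

/-- `p(n,x)`: the probability that a Hamiltonian path with one end at `o`
has its other end at `x` -/
def p (n : ℕ) (x : ℝ × ℝ) : ℝ := (f n o x : ℝ) / (H0 n : ℝ)

/-- the mean `ℓ` displacement of Hamiltonian paths on `SG n` with one end at `o` -/
def xi (n : ℕ) (ℓ : ℝ) : ℝ :=
  ∑ᶠ x ∈ {x : ℝ × ℝ | x ∈ V n ∧ x ≠ o}, enorm x ^ ℓ * p n x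

/-- the partition function of Hamiltonian paths on `SG n` -/
def Z (n : ℕ) (β : ℝ) : ℝ := (H n : ℝ) * Real.exp (-(β * ((3 ^ (n + 1) + 1) / 2)))


section HamLists

variable {α : Type*}

/-- The lists enumerating the Hamiltonian paths from `u` to `v` of the graph `adj`
restricted to the vertex set `S`. -/
def hamLists (adj : α → α → Prop) (S : Set α) (u v : α) : Set (List α) :=
  {l | l.Nodup ∧ l.IsChain adj ∧ l.head? = some u ∧ l.getLast? = some v ∧ ∀ x, x ∈ l ↔ x ∈ S}

/-- The number of Hamiltonian paths from `u` to `v` of the graph `adj` restricted to `S`. -/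
def hamCount (adj : α → α → Prop) (S : Set α) (u v : α) : ℕ := (hamLists adj S u v).ncard

/-- No edge of `adj` joins `A \ B` and `B \ A`. -/
def Separated (adj : α → α → Prop) (A B : Set α) : Prop :=
  ∀ x ∈ A, ∀ y ∈ B, adj x y ∨ adj y x → x ∈ B ∨ y ∈ A

theorem Separated.symm {adj : α → α → Prop} {A B : Set α} (h : Separated adj A B) :
    Separated adj B A := fun x hx y hy hxy => (h y hy x hx hxy.symm).symm

theorem hamLists_finite {adj : α → α → Prop} {S : Set α} {u v : α} :
    (hamLists adj S u v).Finite := by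
  rcases (hamLists adj S u v).eq_empty_or_nonempty with h | ⟨l, hl⟩
  · simp [h]
  · refine (List.finite_toSet l.permutations).subset fun m hm => ?_
    simp only [Set.mem_ofPred_eq, List.mem_permutations]
    exact (List.perm_ext_iff_of_nodup hm.1 hl.1).2 fun x => by rw [hm.2.2.2.2, hl.2.2.2.2]

theorem length_eq_of_mem_hamLists {adj : α → α → Prop} {S : Set α} {u v u' v' : α} {l m : List α}
    (hl : l ∈ hamLists adj S u v) (hm : m ∈ hamLists adj S u' v') : l.length = m.length :=
  ((List.perm_ext_iff_of_nodup hl.1 hm.1).2 fun x => by rw [hl.2.2.2.2, hm.2.2.2.2]).length_eq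

theorem hamCount_congr {adj adj' : α → α → Prop} {S : Set α}
    (h : ∀ x ∈ S, ∀ y ∈ S, (adj x y ↔ adj' x y)) (u v : α) :
    hamCount adj S u v = hamCount adj' S u v := by
  unfold hamCount
  congr 1
  ext l
  constructor
  · rintro ⟨h1, h2, h3, h4, h5⟩
    exact ⟨h1, List.IsChain.imp_of_mem_imp
      (fun x y hx hy => (h x ((h5 x).1 hx) y ((h5 y).1 hy)).1) h2, h3, h4, h5⟩
  · rintro ⟨h1, h2, h3, h4, h5⟩
    exact ⟨h1, List.IsChain.imp_of_mem_imp
      (fun x y hx hy => (h x ((h5 x).1 hx) y ((h5 y).1 hy)).2) h2, h3, h4, h5⟩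

theorem hamCount_image {β : Type*} {adj : α → α → Prop} {adj' : β → β → Prop} {S : Set α}
    {φ : α → β} (hφ : Function.Injective φ)
    (h : ∀ x ∈ S, ∀ y ∈ S, (adj' (φ x) (φ y) ↔ adj x y)) (u v : α) :
    hamCount adj' (φ '' S) (φ u) (φ v) = hamCount adj S u v := by
  have key : hamLists adj' (φ '' S) (φ u) (φ v) = List.map φ '' hamLists adj S u v := by
    ext m
    constructor
    · rintro ⟨h1, h2, h3, h4, h5⟩
      obtain ⟨l, rfl⟩ : ∃ l, List.map φ l = m := by
        have : m ∈ Set.range (List.map φ) := by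
          rw [Set.range_list_map]
          intro x hx
          obtain ⟨y, -, rfl⟩ := (h5 x).1 hx
          exact ⟨y, rfl⟩
        exact this
      have h5' : ∀ x, x ∈ l ↔ x ∈ S := fun x => by
        have := h5 (φ x)
        rwa [List.mem_map_of_injective hφ, hφ.mem_set_image] at this
      refine ⟨l, ⟨(List.nodup_map_iff hφ).1 h1, ?_, ?_, ?_, h5'⟩, rfl⟩
      · rw [List.isChain_map] at h2
        exact List.IsChain.imp_of_mem_imp
          (fun x y hx hy => (h x ((h5' x).1 hx) y ((h5' y).1 hy)).1) h2
      · simpa [hφ.eq_iff] using h3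
      · simpa [hφ.eq_iff] using h4
    · rintro ⟨l, ⟨h1, h2, h3, h4, h5⟩, rfl⟩
      refine ⟨(List.nodup_map_iff hφ).2 h1, ?_, by simp [h3], by simp [h4], fun x => ?_⟩
      · rw [List.isChain_map]
        exact List.IsChain.imp_of_mem_imp
          (fun x y hx hy => (h x ((h5 x).1 hx) y ((h5 y).1 hy)).2) h2
      · simp [h5]
  rw [hamCount, key, Set.ncard_image_of_injective _ hφ.list_map, hamCount]

theorem hamCount_comm {adj : α → α → Prop} (hadj : ∀ x y, adj x y → adj y x) (S : Set α)
    (u v : α) : hamCount adj S u v = hamCount adj S v u := by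
  have key : ∀ u v, ∀ l ∈ hamLists adj S u v, l.reverse ∈ hamLists adj S v u := by
    rintro u v l ⟨h1, h2, h3, h4, h5⟩
    refine ⟨List.nodup_reverse.2 h1, ?_, by simpa using h4, by simpa using h3, by simpa using h5⟩
    rw [List.isChain_reverse]
    exact h2.imp fun x y => hadj x y
  unfold hamCount
  rw [← Set.ncard_image_of_injective (hamLists adj S u v) List.reverse_injective]
  congr 1
  ext l
  refine ⟨?_, fun hl => ⟨l.reverse, key _ _ _ hl, l.reverse_reverse⟩⟩
  rintro ⟨m, hm, rfl⟩
  exact key _ _ _ hm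

theorem hamCount_eq_zero_of_notMem {adj : α → α → Prop} {S : Set α} {u v : α}
    (h : u ∉ S ∨ v ∉ S) : hamCount adj S u v = 0 := by
  rw [hamCount, Set.ncard_eq_zero hamLists_finite, Set.eq_empty_iff_forall_notMem]
  rintro l ⟨-, -, h3, h4, h5⟩
  rcases h with h | h
  · exact h ((h5 _).1 (List.mem_of_head? h3))
  · exact h ((h5 _).1 (List.mem_of_getLast? h4))

/-- A path that leaves `A` does so through `A ∩ B`. -/
theorem exists_exit {adj : α → α → Prop} {A B : Set α} (hs : Separated adj A B) :
    ∀ {l : List α}, l.IsChain adj → (∀ x ∈ l, x ∈ A ∪ B) → (∀ u ∈ l.head?, u ∈ A) →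
      (∃ y ∈ l, y ∉ A) → ∃ l₁ w y l₂, l = l₁ ++ w :: y :: l₂ ∧ (∀ x ∈ l₁, x ∈ A) ∧
        w ∈ A ∧ w ∈ B ∧ y ∉ A
  | [], _, _, _, ⟨y, hy, _⟩ => by simp at hy
  | [x], _, _, hh, ⟨y, hy, hyA⟩ => by
    simp only [List.mem_singleton] at hy
    exact absurd (hh x (by simp)) (hy ▸ hyA)
  | x :: z :: t, hc, hsub, hh, ⟨y, hy, hyA⟩ => by
    have hx : x ∈ A := hh x (by simp)
    rw [List.isChain_cons_cons] at hc
    by_cases hz : z ∈ A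
    · obtain ⟨l₁, w, y', l₂, h1, h2, h3⟩ := exists_exit hs hc.2
        (fun u hu => hsub u (List.mem_cons_of_mem _ hu)) (by simpa using hz)
        ⟨y, (List.mem_cons.1 hy).resolve_left fun h => hyA (h ▸ hx), hyA⟩
      refine ⟨x :: l₁, w, y', l₂, by rw [h1]; rfl, ?_, h3⟩
      simpa [hx] using h2
    · have hzB : z ∈ B := (hsub z (by simp)).resolve_left hz
      exact ⟨[], x, z, t, rfl, by simp, hx,
        (hs x hx z hzB (Or.inl hc.1)).resolve_right hz, hz⟩

/-- A path avoiding `A ∩ B` and starting outside of `A` stays outside of `A`. -/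
theorem forall_notMem_of_avoid {adj : α → α → Prop} {A B : Set α} (hs : Separated adj A B)
    {l : List α} (hc : l.IsChain adj) (hsub : ∀ x ∈ l, x ∈ A ∪ B)
    (hh : ∀ u ∈ l.head?, u ∉ A) (hav : ∀ x ∈ l, x ∈ A → x ∉ B) : ∀ x ∈ l, x ∉ A := by
  have hB : ∀ x ∈ l, x ∈ B := by
    by_contra! hcon
    obtain ⟨l₁, w, y, l₂, rfl, -, hw, hw', -⟩ := exists_exit hs.symm hc
      (fun x hx => (hsub x hx).symm)
      (fun u hu => (hsub u (List.mem_of_head? hu)).resolve_left (hh u hu)) hcon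
    exact hav w (by simp) hw' hw
  exact fun x hx hxA => hav x hx hxA (hB x hx)

/-- The concatenations at `p` of a Hamiltonian path of `A` from `u` to `p` and a Hamiltonian path
of `B` from `p` to `v`. -/
def splicedLists (adj : α → α → Prop) (A B : Set α) (u p v : α) : Set (List α) :=
  (fun m : List α × List α => m.1 ++ m.2.tail) '' (hamLists adj A u p ×ˢ hamLists adj B p v)

theorem ncard_splicedLists (adj : α → α → Prop) (A B : Set α) (u p v : α) :
    (splicedLists adj A B u p v).ncard = hamCount adj A u p * hamCount adj B p v := by
  rw [splicedLists, Set.InjOn.ncard_image, Set.ncard_prod, hamCount, hamCount]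
  rintro ⟨m, n⟩ ⟨hm, hn⟩ ⟨m', n'⟩ ⟨hm', hn'⟩ h
  obtain ⟨h1, h2⟩ := List.append_inj h (length_eq_of_mem_hamLists hm hm')
  obtain ⟨t, ht⟩ := List.head?_eq_some_iff.1 hn.2.2.1
  obtain ⟨t', ht'⟩ := List.head?_eq_some_iff.1 hn'.2.2.1
  simp only at h1 h2 ht ht'
  subst ht ht' h1
  simpa using h2

theorem mem_splicedLists {adj : α → α → Prop} {A B : Set α} {u p v : α} {l : List α} :
    l ∈ splicedLists adj A B u p v ↔ ∃ l₁ l₂, l = l₁ ++ p :: l₂ ∧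
      l₁ ++ [p] ∈ hamLists adj A u p ∧ p :: l₂ ∈ hamLists adj B p v := by
  constructor
  · rintro ⟨⟨m, n⟩, ⟨hm, hn⟩, rfl⟩
    obtain ⟨t, ht⟩ := List.head?_eq_some_iff.1 hn.2.2.1
    obtain ⟨s, hs⟩ := List.getLast?_eq_some_iff.1 hm.2.2.2.1
    simp only at ht hs
    subst ht hs
    exact ⟨s, t, by simp, hm, hn⟩
  · rintro ⟨l₁, l₂, rfl, h1, h2⟩
    exact ⟨(l₁ ++ [p], p :: l₂), ⟨h1, h2⟩, by simp⟩

theorem splicedLists_subset {adj : α → α → Prop} {A B S : Set α} {u p v : α}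
    (hS : S = A ∪ B) (hAB : ∀ x ∈ A, x ∈ B → x = p) :
    splicedLists adj A B u p v ⊆ hamLists adj S u v := by
  subst hS
  intro l hl
  obtain ⟨l₁, l₂, rfl, ⟨h1, h2, h3, -, h5⟩, k1, k2, -, k4, k5⟩ := mem_splicedLists.1 hl
  refine ⟨?_, List.isChain_split.2 ⟨h2, k2⟩, ?_, ?_, fun x => ?_⟩
  · rw [List.nodup_append] at h1 ⊢
    refine ⟨h1.1, k1, fun x hx y hy hxy => ?_⟩
    subst hxy
    exact h1.2.2 x hx p (by simp) (hAB x ((h5 x).1 (by simp [hx])) ((k5 x).1 hy))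
  · cases l₁ <;> simpa using h3
  · simpa [List.getLast?_append] using k4
  · rw [Set.mem_union, ← h5, ← k5]
    simp only [List.mem_append, List.mem_cons, List.not_mem_nil]
    tauto

theorem mem_splicedLists_of_split {adj : α → α → Prop} {A B S : Set α} {u p v : α}
    (hS : S = A ∪ B) (hAB : ∀ x ∈ A, x ∈ B → x = p) (hpA : p ∈ A) (hpB : p ∈ B)
    {l₁ l₂ : List α} (hl : l₁ ++ p :: l₂ ∈ hamLists adj S u v)
    (h₁ : ∀ x ∈ l₁, x ∈ A) (h₂ : ∀ x ∈ l₂, x ∈ B) :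
    l₁ ++ p :: l₂ ∈ splicedLists adj A B u p v := by
  subst hS
  obtain ⟨h1, h2, h3, h4, h5⟩ := hl
  rw [List.isChain_split] at h2
  refine mem_splicedLists.2 ⟨l₁, l₂, rfl, ⟨?_, h2.1, ?_, by simp, fun x => ?_⟩,
    (List.nodup_append.1 h1).2.1, h2.2, rfl, ?_, fun x => ?_⟩
  · exact h1.sublist (by simp)
  · cases l₁ <;> simpa using h3
  · have := h5 x
    simp only [List.mem_append, List.mem_cons, Set.mem_union, List.not_mem_nil, or_false] at this ⊢
    constructor
    · rintro (h | rfl)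
      exacts [h₁ x h, hpA]
    · intro h
      by_cases hx : x ∈ B
      · exact Or.inr (hAB x h hx)
      · have := this.2 (Or.inl h)
        exact this.imp_right fun h => h.resolve_right fun h' => hx (h₂ x h')
  · simpa [List.getLast?_append] using h4
  · have := h5 x
    simp only [List.mem_append, List.mem_cons, Set.mem_union] at this ⊢
    constructor
    · rintro (rfl | h)
      exacts [hpB, h₂ x h]
    · intro h
      by_cases hx : x ∈ A
      · exact Or.inl (hAB x hx h)
      · exact (this.2 (Or.inr h)).resolve_left fun h' => hx (h₁ x h')

theorem hamLists_exists_exit {adj : α → α → Prop} {A B : Set α} {u v : α} {l : List α}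
    (hs : Separated adj A B) (hu : u ∈ A) (hBA : ∃ y ∈ B, y ∉ A)
    (hl : l ∈ hamLists adj (A ∪ B) u v) :
    ∃ l₁ w y l₂, l = l₁ ++ w :: y :: l₂ ∧ (∀ x ∈ l₁, x ∈ A) ∧ w ∈ A ∧ w ∈ B ∧ y ∉ A := by
  obtain ⟨-, h2, h3, -, h5⟩ := hl
  obtain ⟨y, hy, hyA⟩ := hBA
  refine exists_exit hs h2 (fun x => (h5 x).1) (fun x hx => ?_) ⟨y, (h5 y).2 (Or.inr hy), hyA⟩
  rw [h3, Option.mem_some_iff] at hx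
  exact hx ▸ hu

/-- A path cannot visit what lies behind a cut vertex and come back. -/
theorem hamCount_eq_zero_of_cut {adj : α → α → Prop} {A B : Set α} {u v p : α}
    (hs : Separated adj A B) (hAB : ∀ x ∈ A, x ∈ B → x = p) (hBA : ∃ y ∈ B, y ∉ A)
    (hu : u ∈ A) (hv : v ∈ A) : hamCount adj (A ∪ B) u v = 0 := by
  rw [hamCount, Set.ncard_eq_zero hamLists_finite, Set.eq_empty_iff_forall_notMem]
  intro l hl
  obtain ⟨l₁, w, y, l₂, rfl, -, hw, hw', hy⟩ := hamLists_exists_exit hs hu hBA hl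
  obtain rfl := hAB w hw hw'
  obtain ⟨h1, h2, -, h4, h5⟩ := hl
  have hnd := (List.nodup_append.1 h1).2.1
  refine forall_notMem_of_avoid hs (l := y :: l₂) (List.isChain_split.1 h2).2.tail
    (fun x hx => (h5 x).1 (by simp only [List.mem_append, List.mem_cons] at hx ⊢; tauto))
    (by simpa using hy) (fun x hx hxA hxB => ?_) v (List.mem_of_getLast? ?_) hv
  · obtain rfl := hAB x hxA hxB
    exact (List.nodup_cons.1 hnd).1 hx
  · simpa [List.getLast?_append] using h4

theorem hamCount_cut {adj : α → α → Prop} {A B : Set α} {u v p : α}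
    (hs : Separated adj A B) (hAB : ∀ x ∈ A, x ∈ B → x = p) (hpA : p ∈ A) (hpB : p ∈ B)
    (hBA : ∃ y ∈ B, y ∉ A) (hu : u ∈ A) :
    hamCount adj (A ∪ B) u v = hamCount adj A u p * hamCount adj B p v := by
  rw [← ncard_splicedLists, hamCount]
  congr 1
  refine (Set.Subset.antisymm (fun l hl => ?_) (splicedLists_subset rfl hAB))
  obtain ⟨l₁, w, y, l₂, rfl, h₁, hw, hw', hy⟩ := hamLists_exists_exit hs hu hBA hl
  obtain rfl := hAB w hw hw'
  refine mem_splicedLists_of_split rfl hAB hpA hpB hl h₁ fun x hx => ?_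
  obtain ⟨hn, h2, -, h4, h5⟩ := hl
  have hnd := (List.nodup_append.1 hn).2.1
  have hsub : ∀ x ∈ y :: l₂, x ∈ A ∪ B := fun x hx =>
    (h5 x).1 (by simp only [List.mem_append, List.mem_cons] at hx ⊢; tauto)
  refine (hsub x hx).resolve_left
    (forall_notMem_of_avoid hs (List.isChain_split.1 h2).2.tail hsub (by simpa using hy)
      (fun x hx hxA hxB => ?_) x hx)
  obtain rfl := hAB x hxA hxB
  exact (List.nodup_cons.1 hnd).1 hx

/-- A path through the 2-cut `{p, q}` from `A` to `B` that leaves `A` at `p`. -/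
theorem mem_splicedLists_of_exit {adj : α → α → Prop} {A B : Set α} {u v p q : α}
    (hs : Separated adj A B) (hAB : ∀ x ∈ A, x ∈ B → x = p ∨ x = q) (hpq : p ≠ q)
    (hpA : p ∈ A) (hpB : p ∈ B) (hqA : q ∈ A) (hqB : q ∈ B) (hv : v ∈ B)
    {l₁ l₂ : List α} {y : α} (hl : l₁ ++ p :: y :: l₂ ∈ hamLists adj (A ∪ B) u v)
    (h₁ : ∀ x ∈ l₁, x ∈ A) (hy : y ∉ A) :
    l₁ ++ p :: y :: l₂ ∈ splicedLists adj A (B \ {q}) u p v ∪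
      splicedLists adj (A \ {q}) B u p v := by
  have hl' := hl
  obtain ⟨hn, h2, -, h4, h5⟩ := hl'
  have hc := (List.isChain_split.1 h2).2.tail
  simp only [List.tail_cons] at hc
  have hnd := List.nodup_append.1 hn
  have hp : p ∉ y :: l₂ := (List.nodup_cons.1 hnd.2.1).1
  have hsub : ∀ x ∈ y :: l₂, x ∈ A ∪ B := fun x hx =>
    (h5 x).1 (by simp only [List.mem_append, List.mem_cons] at hx ⊢; tauto)
  have h₂ : ∀ x ∈ y :: l₂, x ∈ B := by
    by_cases hq : q ∈ y :: l₂
    · obtain ⟨m₁, m₂, hm⟩ := List.append_of_mem hq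
      rw [hm] at hc hsub hp
      have hnd' := hnd.2.1
      rw [hm] at hnd'
      have hnm := List.nodup_append.1 (List.nodup_cons.1 hnd').2
      have hqm₁ : q ∉ m₁ := fun h => hnm.2.2 q h q (by simp) rfl
      have hqm₂ : q ∉ m₂ := (List.nodup_cons.1 hnm.2.1).1
      have hA₁ : ∀ x ∈ m₁, x ∉ A := by
        refine forall_notMem_of_avoid hs hc.left_of_append
          (fun x hx => hsub x (by simp [hx])) (fun x hx => ?_) (fun x hx hxA hxB => ?_)
        · cases m₁ with
          | nil => simp at hx
          | cons z t =>
            simp only [List.cons_append, List.cons.injEq] at hm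
            simp only [List.head?_cons, Option.mem_some_iff] at hx
            exact hx ▸ hm.1 ▸ hy
        · rcases hAB x hxA hxB with rfl | rfl
          · exact hp (by simp [hx])
          · exact hqm₁ hx
      have hA₂ : ∀ x ∈ m₂, x ∈ B := by
        by_contra! hcon
        have hav : ∀ x ∈ m₂, x ∈ A → x ∉ B := fun x hx hxA hxB => by
          rcases hAB x hxA hxB with rfl | rfl
          · exact hp (by simp [hx])
          · exact hqm₂ hx
        have hcm := hc.right_of_append.tail
        simp only [List.tail_cons] at hcm
        have hsubm : ∀ x ∈ m₂, x ∈ A ∪ B := fun x hx => hsub x (by simp [hx])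
        obtain ⟨x, hx, hxB⟩ := hcon
        by_cases hh : ∀ u ∈ m₂.head?, u ∉ A
        · exact hxB ((hsubm x hx).resolve_left
            (forall_notMem_of_avoid hs hcm hsubm hh hav x hx))
        · push Not at hh
          obtain ⟨z, hz, hzA⟩ := hh
          have := forall_notMem_of_avoid hs.symm hcm (fun x hx => (hsubm x hx).symm)
            (fun u hu => by
              rw [Option.mem_unique hu hz]
              exact hav z (List.mem_of_head? hz) hzA)
            (fun x hx hxB hxA => hav x hx hxA hxB)
          refine this v (List.mem_of_getLast? ?_) hv
          have he : l₁ ++ p :: (m₁ ++ q :: m₂) = (l₁ ++ p :: (m₁ ++ [q])) ++ m₂ := by simp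
          rwa [hm, he, List.getLast?_append_of_ne_nil _ (List.ne_nil_of_mem hx)] at h4
      intro x hx
      rw [hm, List.mem_append, List.mem_cons] at hx
      rcases hx with hx | rfl | hx
      · exact (hsub x (by simp [hx])).resolve_left (hA₁ x hx)
      · exact hqB
      · exact hA₂ x hx
    · refine fun x hx => (hsub x hx).resolve_left
        (forall_notMem_of_avoid hs hc hsub (by simpa using hy) (fun x hx hxA hxB => ?_) x hx)
      rcases hAB x hxA hxB with rfl | rfl
      exacts [hp hx, hq hx]
  by_cases hq : q ∈ l₁
  · refine Or.inl (mem_splicedLists_of_split (B := B \ {q}) ?_ ?_ hpA ⟨hpB, hpq⟩ hl h₁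
      fun x hx => ⟨h₂ x hx, ?_⟩)
    · ext x
      simp only [Set.mem_union, Set.mem_sdiff, Set.mem_singleton_iff]
      by_cases hx : x = q
      · subst hx; tauto
      · tauto
    · exact fun x hxA hxB => (hAB x hxA hxB.1).resolve_right hxB.2
    · rintro rfl
      exact hnd.2.2 x hq x (List.mem_cons_of_mem _ hx) rfl
  · refine Or.inr (mem_splicedLists_of_split (A := A \ {q}) ?_ ?_ ⟨hpA, hpq⟩ hpB hl
      (fun x hx => ⟨h₁ x hx, fun h => hq (h ▸ hx)⟩) h₂)
    · ext x
      simp only [Set.mem_union, Set.mem_sdiff, Set.mem_singleton_iff]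
      by_cases hx : x = q
      · subst hx; tauto
      · tauto
    · exact fun x hxA hxB => (hAB x hxA.1 hxB).resolve_right hxA.2

theorem disjoint_splicedLists {adj : α → α → Prop} {A B : Set α} {u v p q : α}
    (hqA : q ∈ A) :
    Disjoint (splicedLists adj A (B \ {q}) u p v) (splicedLists adj (A \ {q}) B u p v) := by
  rw [Set.disjoint_left]
  intro l h h'
  obtain ⟨l₁, l₂, rfl, h1, h2⟩ := mem_splicedLists.1 h
  obtain ⟨l₁', l₂', he, h1', h2'⟩ := mem_splicedLists.1 h'
  have hp : p ∉ l₁ := fun hp => (List.nodup_append.1 h1.1).2.2 p hp p (by simp) rfl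
  obtain ⟨rfl, -, rfl⟩ :=
    (List.append_cons_inj_of_notMem hp (List.nodup_cons.1 h2.1).1).1 he
  exact ((h1'.2.2.2.2 q).1 ((h1.2.2.2.2 q).2 hqA)).2 rfl

theorem disjoint_splicedLists_of_not_adj {adj : α → α → Prop} {A B A₁ B₁ A₂ B₂ : Set α}
    {u v p q : α} (hAB : ∀ x ∈ A, x ∈ B → x = p ∨ x = q) (hpq : p ≠ q) (h : ¬ adj p q)
    (h' : ¬ adj q p) (hA₁ : A₁ ⊆ A) (hA₂ : A₂ ⊆ A) (hB₁ : B₁ ⊆ B) (hB₂ : B₂ ⊆ B) :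
    Disjoint (splicedLists adj A₁ B₁ u p v) (splicedLists adj A₂ B₂ u q v) := by
  have key : ∀ {p q : α} {B₁ A₂ : Set α} {m₁ m₂ n₁ n₂ t : List α},
      (∀ x ∈ A, x ∈ B → x = p ∨ x = q) → p ≠ q → ¬ adj p q → B₁ ⊆ B → A₂ ⊆ A →
      p :: m₂ ∈ hamLists adj B₁ p v → n₁ ++ [q] ∈ hamLists adj A₂ u q →
      n₁ = m₁ ++ t → p :: m₂ = t ++ q :: n₂ → False := by
    intro p q B₁ A₂ m₁ m₂ n₁ n₂ t hAB hpq h hB₁ hA₂ hm hn hnm hmn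
    cases t with
    | nil =>
      simp only [List.nil_append, List.cons.injEq] at hmn
      exact hpq hmn.1
    | cons z t =>
      simp only [List.cons_append, List.cons.injEq] at hmn
      obtain ⟨rfl, rfl⟩ := hmn
      cases t with
      | nil => exact h (List.isChain_cons_cons.1 hm.2.1).1
      | cons z t =>
        have hzB : z ∈ B := hB₁ ((hm.2.2.2.2 z).1 (by simp))
        have hzA : z ∈ A := hA₂ ((hn.2.2.2.2 z).1 (by simp [hnm]))
        have hnd := hm.1
        simp only [List.cons_append, List.nodup_cons, List.mem_cons, List.mem_append] at hnd
        rcases hAB z hzA hzB with rfl | rfl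
        · simp at hnd
        · simp at hnd
  rw [Set.disjoint_left]
  intro l hl hl'
  obtain ⟨m₁, m₂, rfl, h1, h2⟩ := mem_splicedLists.1 hl
  obtain ⟨n₁, n₂, he, h1', h2'⟩ := mem_splicedLists.1 hl'
  rcases List.append_eq_append_iff.1 he with ⟨t, ht, ht'⟩ | ⟨t, ht, ht'⟩
  · exact key hAB hpq h hB₁ hA₂ h2 h1' ht ht'
  · exact key (fun x hx hx' => (hAB x hx hx').symm) hpq.symm h'
      hB₂ hA₁ h2' h1 ht ht'

theorem hamCount_two_cut {adj : α → α → Prop} {A B : Set α} {u v p q : α}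
    (hs : Separated adj A B) (hAB : ∀ x ∈ A, x ∈ B → x = p ∨ x = q) (hpq : p ≠ q)
    (h : ¬ adj p q) (h' : ¬ adj q p)
    (hpA : p ∈ A) (hpB : p ∈ B) (hqA : q ∈ A) (hqB : q ∈ B) (hBA : ∃ y ∈ B, y ∉ A)
    (hu : u ∈ A) (hv : v ∈ B) :
    hamCount adj (A ∪ B) u v =
      (hamCount adj A u p * hamCount adj (B \ {q}) p v +
        hamCount adj (A \ {q}) u p * hamCount adj B p v) +
      (hamCount adj A u q * hamCount adj (B \ {p}) q v +
        hamCount adj (A \ {p}) u q * hamCount adj B q v) := by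
  have hfin : ∀ A B : Set α, ∀ p, (splicedLists adj A B u p v).Finite := fun A B p =>
    (hamLists_finite.prod hamLists_finite).image _
  have hAB' : ∀ x ∈ A, x ∈ B → x = q ∨ x = p := fun x hx hx' => (hAB x hx hx').symm
  have hdis : ∀ {A₁ B₁ A₂ B₂ : Set α}, A₁ ⊆ A → A₂ ⊆ A → B₁ ⊆ B → B₂ ⊆ B →
      Disjoint (splicedLists adj A₁ B₁ u p v) (splicedLists adj A₂ B₂ u q v) :=
    disjoint_splicedLists_of_not_adj hAB hpq h h'
  have hun : ∀ {r : α}, r ∈ A → r ∈ B → A ∪ B = A ∪ B \ {r} ∧ A ∪ B = A \ {r} ∪ B := by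
    intro r hrA hrB
    constructor <;>
    · ext x
      simp only [Set.mem_union, Set.mem_sdiff, Set.mem_singleton_iff]
      by_cases hx : x = r
      · subst hx; tauto
      · tauto
  have key : hamLists adj (A ∪ B) u v =
      (splicedLists adj A (B \ {q}) u p v ∪ splicedLists adj (A \ {q}) B u p v) ∪
        (splicedLists adj A (B \ {p}) u q v ∪ splicedLists adj (A \ {p}) B u q v) := by
    refine Set.Subset.antisymm (fun l hl => ?_) ?_
    · obtain ⟨l₁, w, y, l₂, rfl, h₁, hw, hw', hy⟩ := hamLists_exists_exit hs hu hBA hl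
      rcases hAB w hw hw' with rfl | rfl
      · exact Or.inl (mem_splicedLists_of_exit hs hAB hpq hpA hpB hqA hqB hv hl h₁ hy)
      · exact Or.inr (mem_splicedLists_of_exit hs hAB' hpq.symm hqA hqB hpA hpB hv hl h₁ hy)
    · refine Set.union_subset (Set.union_subset ?_ ?_) (Set.union_subset ?_ ?_)
      · exact splicedLists_subset (hun hqA hqB).1
          fun x hx hx' => (hAB x hx hx'.1).resolve_right hx'.2
      · exact splicedLists_subset (hun hqA hqB).2
          fun x hx hx' => (hAB x hx.1 hx').resolve_right hx.2
      · exact splicedLists_subset (hun hpA hpB).1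
          fun x hx hx' => (hAB x hx hx'.1).resolve_left hx'.2
      · exact splicedLists_subset (hun hpA hpB).2
          fun x hx hx' => (hAB x hx.1 hx').resolve_left hx.2
  rw [hamCount, key, Set.ncard_union_eq _ ((hfin _ _ _).union (hfin _ _ _))
    ((hfin _ _ _).union (hfin _ _ _)), Set.ncard_union_eq (disjoint_splicedLists hqA)
      (hfin _ _ _) (hfin _ _ _), Set.ncard_union_eq (disjoint_splicedLists hpA)
      (hfin _ _ _) (hfin _ _ _)]
  · simp only [ncard_splicedLists]
  · rw [Set.disjoint_union_left, Set.disjoint_union_right, Set.disjoint_union_right]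
    exact ⟨⟨hdis le_rfl le_rfl Set.sdiff_subset Set.sdiff_subset,
      hdis le_rfl Set.sdiff_subset Set.sdiff_subset le_rfl⟩,
      hdis Set.sdiff_subset le_rfl le_rfl Set.sdiff_subset,
      hdis Set.sdiff_subset Set.sdiff_subset le_rfl le_rfl⟩

/-- The pairs `(l₁, l₂)` such that `l₁ ++ [p]` and `q :: l₂` are disjoint paths, from `u` to `p` and
from `q` to `v`, that together visit every vertex of `A`. -/
def pathPairs (adj : α → α → Prop) (A : Set α) (u p q v : α) : Set (List α × List α) :=
  {d | (d.1 ++ p :: q :: d.2).Nodup ∧ (d.1 ++ [p]).IsChain adj ∧ (q :: d.2).IsChain adj ∧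
    (d.1 ++ [p]).head? = some u ∧ (q :: d.2).getLast? = some v ∧
    ∀ x, x ∈ d.1 ++ p :: q :: d.2 ↔ x ∈ A}

/-- The paths following a pair of paths in `A` and making a detour through `B` in between. -/
def detourLists (adj : α → α → Prop) (A B : Set α) (u p q v : α) : Set (List α) :=
  (fun m : (List α × List α) × List α => m.1.1 ++ (m.2 ++ m.1.2)) ''
    (pathPairs adj A u p q v ×ˢ hamLists adj B p q)

theorem ncard_detourLists (adj : α → α → Prop) (A B : Set α) (u p q v : α) :
    (detourLists adj A B u p q v).ncard = (pathPairs adj A u p q v).ncard * hamCount adj B p q := by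
  rw [detourLists, Set.InjOn.ncard_image, Set.ncard_prod, hamCount]
  rintro ⟨⟨d, e⟩, m⟩ ⟨hd, hm⟩ ⟨⟨d', e'⟩, m'⟩ ⟨hd', hm'⟩ h
  obtain ⟨t, rfl⟩ := List.head?_eq_some_iff.1 hm.2.2.1
  obtain ⟨t', rfl⟩ := List.head?_eq_some_iff.1 hm'.2.2.1
  have hlen := length_eq_of_mem_hamLists hm hm'
  simp only [List.cons_append, List.length_cons, Nat.add_right_cancel_iff] at h hlen
  have hp : ∀ {d e : List α}, (d, e) ∈ pathPairs adj A u p q v → p ∉ d := fun hd hp =>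
    (List.nodup_append.1 hd.1).2.2 p hp p (by simp) rfl
  have key : d = d' ∧ t ++ e = t' ++ e' := by
    rcases List.append_eq_append_iff.1 h with ⟨s, hs, hs'⟩ | ⟨s, hs, hs'⟩
    · cases s with
      | nil => simpa [hs, eq_comm] using hs'
      | cons x s =>
        simp only [List.cons_append, List.cons.injEq] at hs'
        exact absurd (by simp [hs, hs'.1]) (hp hd')
    · cases s with
      | nil => simpa [hs, eq_comm] using hs'
      | cons x s =>
        simp only [List.cons_append, List.cons.injEq] at hs'
        exact absurd (by simp [hs, hs'.1]) (hp hd)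
  obtain ⟨rfl, h2⟩ := key
  obtain ⟨rfl, rfl⟩ := List.append_inj h2 hlen
  rfl

theorem mem_detourLists {adj : α → α → Prop} {A B : Set α} {u p q v : α} {l : List α}
    (hpq : p ≠ q) :
    l ∈ detourLists adj A B u p q v ↔ ∃ l₁ m l₂, l = l₁ ++ p :: (m ++ q :: l₂) ∧
      (l₁, l₂) ∈ pathPairs adj A u p q v ∧ p :: (m ++ [q]) ∈ hamLists adj B p q := by
  constructor
  · rintro ⟨⟨⟨l₁, l₂⟩, n⟩, ⟨hd, hn⟩, rfl⟩
    obtain ⟨t, rfl⟩ := List.head?_eq_some_iff.1 hn.2.2.1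
    obtain ⟨s, hs⟩ := List.getLast?_eq_some_iff.1 hn.2.2.2.1
    simp only at hs hn hd
    cases s with
    | nil => simp only [List.nil_append, List.cons.injEq] at hs; exact absurd hs.1 hpq
    | cons x s =>
      simp only [List.cons_append, List.cons.injEq] at hs
      obtain ⟨rfl, rfl⟩ := hs
      exact ⟨l₁, s, l₂, by simp, hd, hn⟩
  · rintro ⟨l₁, m, l₂, rfl, h1, h2⟩
    exact ⟨((l₁, l₂), p :: (m ++ [q])), ⟨h1, h2⟩, by simp⟩

theorem detourLists_subset {adj : α → α → Prop} {A B : Set α} {u v p q : α}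
    (hAB : ∀ x ∈ A, x ∈ B → x = p ∨ x = q) (hpq : p ≠ q) :
    detourLists adj A B u p q v ⊆ hamLists adj (A ∪ B) u v := by
  intro l hl
  obtain ⟨l₁, m, l₂, rfl, ⟨h1, h2, h3, h4, h5, h6⟩, k1, k2, -, -, k5⟩ := (mem_detourLists hpq).1 hl
  have hm : ∀ x ∈ m, x ∉ A := by
    intro x hx hxA
    rw [List.nodup_cons, List.nodup_append] at k1
    rcases hAB x hxA ((k5 x).1 (by simp [hx])) with rfl | rfl
    · exact k1.1 (by simp [hx])
    · exact k1.2.2.2 x hx x (by simp) rfl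
  refine ⟨?_, ?_, ?_, ?_, fun x => ?_⟩
  · have hp : (l₁ ++ p :: (m ++ q :: l₂)).Perm (m ++ (l₁ ++ p :: q :: l₂)) := by
      rw [List.perm_iff_count]
      intro x
      simp only [List.count_append, List.count_cons]
      omega
    rw [hp.nodup_iff, List.nodup_append]
    refine ⟨k1.tail.sublist (by simp), h1, fun x hx y hy hxy => ?_⟩
    exact hm x hx ((h6 x).1 (hxy ▸ hy))
  · refine List.isChain_split.2 ⟨h2, ?_⟩
    rw [← List.cons_append]
    exact List.isChain_split.2 ⟨k2, h3⟩
  · cases l₁ <;> simpa using h4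
  · have he : l₁ ++ p :: (m ++ q :: l₂) = (l₁ ++ p :: m) ++ q :: l₂ := by simp
    rw [he, List.getLast?_append_of_ne_nil _ (by simp)]
    exact h5
  · rw [Set.mem_union, ← h6, ← k5]
    simp only [List.mem_append, List.mem_cons, List.not_mem_nil]
    tauto

theorem mem_detourLists_of_exit {adj : α → α → Prop} {A B : Set α} {u v p q : α}
    (hs : Separated adj A B) (hAB : ∀ x ∈ A, x ∈ B → x = p ∨ x = q) (hpq : p ≠ q)
    (hpA : p ∈ A) (hpB : p ∈ B) (hqA : q ∈ A) (hqB : q ∈ B) (hv : v ∈ A)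
    {l₁ l₂ : List α} {y : α} (hl : l₁ ++ p :: y :: l₂ ∈ hamLists adj (A ∪ B) u v)
    (h₁ : ∀ x ∈ l₁, x ∈ A) (hy : y ∉ A) :
    l₁ ++ p :: y :: l₂ ∈ detourLists adj A B u p q v := by
  obtain ⟨hn, h2, h3, h4, h5⟩ := hl
  have hc := (List.isChain_split.1 h2).2.tail
  simp only [List.tail_cons] at hc
  have hnd := List.nodup_append.1 hn
  have hp : p ∉ y :: l₂ := (List.nodup_cons.1 hnd.2.1).1
  have hsub : ∀ x ∈ y :: l₂, x ∈ A ∪ B := fun x hx =>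
    (h5 x).1 (by simp only [List.mem_append, List.mem_cons] at hx ⊢; tauto)
  have hq : q ∈ y :: l₂ := by
    by_contra hq
    refine forall_notMem_of_avoid hs hc hsub (by simpa using hy) (fun x hx hxA hxB => ?_) v
      (List.mem_of_getLast? (by simpa [List.getLast?_append] using h4)) hv
    rcases hAB x hxA hxB with rfl | rfl
    exacts [hp hx, hq hx]
  obtain ⟨m₁, m₂, hm⟩ := List.append_of_mem hq
  rw [hm] at hc hsub hp hn h2 h3 h4 h5 hnd ⊢
  have hnm := List.nodup_append.1 (List.nodup_cons.1 hnd.2.1).2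
  have hqm₁ : q ∉ m₁ := fun h => hnm.2.2 q h q (by simp) rfl
  have hqm₂ : q ∉ m₂ := (List.nodup_cons.1 hnm.2.1).1
  have hA₁ : ∀ x ∈ m₁, x ∉ A := by
    refine forall_notMem_of_avoid hs hc.left_of_append
      (fun x hx => hsub x (by simp [hx])) (fun x hx => ?_) (fun x hx hxA hxB => ?_)
    · cases m₁ with
      | nil => simp at hx
      | cons z t =>
        simp only [List.cons_append, List.cons.injEq] at hm
        simp only [List.head?_cons, Option.mem_some_iff] at hx
        exact hx ▸ hm.1 ▸ hy
    · rcases hAB x hxA hxB with rfl | rfl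
      · exact hp (by simp [hx])
      · exact hqm₁ hx
  have hav : ∀ x ∈ m₂, x ∈ A → x ∉ B := fun x hx hxA hxB => by
    rcases hAB x hxA hxB with rfl | rfl
    · exact hp (by simp [hx])
    · exact hqm₂ hx
  have hlast : ∀ z ∈ m₂, v ∈ m₂ := fun z hz => by
    refine List.mem_of_getLast? (l := m₂) ?_
    have he : l₁ ++ p :: (m₁ ++ q :: m₂) = (l₁ ++ p :: (m₁ ++ [q])) ++ m₂ := by simp
    rwa [he, List.getLast?_append_of_ne_nil _ (List.ne_nil_of_mem hz)] at h4
  have hA₂ : ∀ x ∈ m₂, x ∈ A := by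
    have hcm := hc.right_of_append.tail
    simp only [List.tail_cons] at hcm
    have hsubm : ∀ x ∈ m₂, x ∈ A ∪ B := fun x hx => hsub x (by simp [hx])
    intro x hx
    by_cases hh : ∀ u ∈ m₂.head?, u ∉ A
    · exact absurd hv (forall_notMem_of_avoid hs hcm hsubm hh hav v (hlast x hx))
    · push Not at hh
      obtain ⟨z, hz, hzA⟩ := hh
      refine (hsubm x hx).resolve_right
        (forall_notMem_of_avoid hs.symm hcm (fun x hx => (hsubm x hx).symm)
        (fun u hu => ?_) (fun x hx hxB hxA => hav x hx hxA hxB) x hx)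
      rw [Option.mem_unique hu hz]
      exact hav z (List.mem_of_head? hz) hzA
  refine (mem_detourLists hpq).2 ⟨l₁, m₁, m₂, rfl, ⟨?_, ?_, ?_, ?_, ?_, fun x => ?_⟩,
    ?_, ?_, rfl, ?_, fun x => ?_⟩
  · exact hn.sublist (by simp)
  · exact (List.isChain_split.1 h2).1
  · exact hc.right_of_append
  · cases l₁ <;> simpa using h3
  · have he : l₁ ++ p :: (m₁ ++ q :: m₂) = (l₁ ++ p :: m₁) ++ q :: m₂ := by simp
    rwa [he, List.getLast?_append_of_ne_nil _ (by simp)] at h4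
  · have := h5 x
    simp only [List.mem_append, List.mem_cons, Set.mem_union] at this ⊢
    constructor
    · rintro (h | rfl | rfl | h)
      exacts [h₁ x h, hpA, hqA, hA₂ x h]
    · intro hx
      have := this.2 (Or.inl hx)
      have := hA₁ x
      tauto
  · exact hn.sublist (by simp)
  · have := (List.isChain_split.1 h2).2
    rw [← List.cons_append, List.isChain_split] at this
    exact this.1
  · rw [← List.cons_append, List.getLast?_append_of_ne_nil _ (by simp)]
    rfl
  · have := h5 x
    simp only [List.mem_append, List.mem_cons, Set.mem_union, List.not_mem_nil, or_false]
      at this ⊢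
    constructor
    · rintro (rfl | h | rfl)
      exacts [hpB, (hsub x (by simp [h])).resolve_left (hA₁ x h), hqB]
    · intro hx
      rcases this.2 (Or.inr hx) with h | rfl | h | rfl | h
      · have := hAB x (h₁ x h) hx
        tauto
      · exact Or.inl rfl
      · exact Or.inr (Or.inl h)
      · exact Or.inr (Or.inr rfl)
      · exact absurd hx (hav x h (hA₂ x h))

theorem idxOf_lt_of_mem_detourLists {adj : α → α → Prop} {A B : Set α} {u v p q : α}
    (hAB : ∀ x ∈ A, x ∈ B → x = p ∨ x = q) (hpq : p ≠ q)
    {l : List α} (hl : l ∈ detourLists adj A B u p q v) : l.idxOf p < l.idxOf q := by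
  have hn := (detourLists_subset hAB hpq hl).1
  obtain ⟨l₁, m, l₂, rfl, -⟩ := (mem_detourLists hpq).1 hl
  rw [List.nodup_append] at hn
  have hp : p ∉ l₁ := fun h => hn.2.2 p h p (by simp) rfl
  have hq : q ∉ l₁ := fun h => hn.2.2 q h q (by simp) rfl
  rw [List.idxOf_append, List.idxOf_append, if_neg hp, if_neg hq, List.idxOf_cons_self,
    List.idxOf_cons_ne _ hpq]
  omega

/-- The number of Hamiltonian paths with both ends in `A` depends on `B` only through its numbers
of crossings. -/
theorem hamCount_detour {adj : α → α → Prop} {A B : Set α} {u v p q : α}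
    (hs : Separated adj A B) (hAB : ∀ x ∈ A, x ∈ B → x = p ∨ x = q) (hpq : p ≠ q)
    (hpA : p ∈ A) (hpB : p ∈ B) (hqA : q ∈ A) (hqB : q ∈ B) (hBA : ∃ y ∈ B, y ∉ A)
    (hu : u ∈ A) (hv : v ∈ A) :
    hamCount adj (A ∪ B) u v =
      (pathPairs adj A u p q v).ncard * hamCount adj B p q +
        (pathPairs adj A u q p v).ncard * hamCount adj B q p := by
  have hAB' : ∀ x ∈ A, x ∈ B → x = q ∨ x = p := fun x hx hx' => (hAB x hx hx').symm
  have key : hamLists adj (A ∪ B) u v =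
      detourLists adj A B u p q v ∪ detourLists adj A B u q p v := by
    refine Set.Subset.antisymm (fun l hl => ?_)
      (Set.union_subset (detourLists_subset hAB hpq) (detourLists_subset hAB' hpq.symm))
    obtain ⟨l₁, w, y, l₂, rfl, h₁, hw, hw', hy⟩ := hamLists_exists_exit hs hu hBA hl
    rcases hAB w hw hw' with rfl | rfl
    · exact Or.inl (mem_detourLists_of_exit hs hAB hpq hpA hpB hqA hqB hv hl h₁ hy)
    · exact Or.inr (mem_detourLists_of_exit hs hAB' hpq.symm hqA hqB hpA hpB hv hl h₁ hy)
  rw [hamCount, key, Set.ncard_union_eq _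
    (hamLists_finite.subset (detourLists_subset hAB hpq))
    (hamLists_finite.subset (detourLists_subset hAB' hpq.symm)), ncard_detourLists,
    ncard_detourLists]
  rw [Set.disjoint_left]
  intro l hl hl'
  exact lt_asymm (idxOf_lt_of_mem_detourLists hAB hpq hl)
    (idxOf_lt_of_mem_detourLists hAB' hpq.symm hl')

/-- Three vertex sets glued along the three corners `p`, `q`, `r` of a triangle. -/
structure Triangle (adj : α → α → Prop) (X Y Z : Set α) (p q r : α) : Prop where
  symm : ∀ x y, adj x y → adj y x
  not_adj : ¬ adj p q
  ne_pq : p ≠ q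
  ne_pr : p ≠ r
  ne_qr : q ≠ r
  sep_XY : Separated adj X Y
  sep_XZ : Separated adj X Z
  sep_YZ : Separated adj Y Z
  inter_XY : ∀ x, x ∈ X ∧ x ∈ Y ↔ x = p
  inter_XZ : ∀ x, x ∈ X ∧ x ∈ Z ↔ x = q
  inter_YZ : ∀ x, x ∈ Y ∧ x ∈ Z ↔ x = r
  exists_Y : ∃ y ∈ Y, y ≠ p ∧ y ≠ r
  exists_Z : ∃ z ∈ Z, z ≠ q ∧ z ≠ r

namespace Triangle

variable {adj : α → α → Prop} {X Y Z : Set α} {p q r : α}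

theorem separated_union (h : Triangle adj X Y Z p q r) : Separated adj X (Y ∪ Z) := by
  rintro x hx y (hy | hy) hxy
  · exact (h.sep_XY x hx y hy hxy).imp_left Or.inl
  · exact (h.sep_XZ x hx y hy hxy).imp_left Or.inr

theorem eq_or_eq (h : Triangle adj X Y Z p q r) : ∀ x ∈ X, x ∈ Y ∪ Z → x = p ∨ x = q := by
  rintro x hx (hy | hy)
  · exact Or.inl ((h.inter_XY x).1 ⟨hx, hy⟩)
  · exact Or.inr ((h.inter_XZ x).1 ⟨hx, hy⟩)

theorem exists_notMem (h : Triangle adj X Y Z p q r) : ∃ y ∈ Y ∪ Z, y ∉ X := by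
  obtain ⟨y, hy, hyp, -⟩ := h.exists_Y
  exact ⟨y, Or.inl hy, fun hx => hyp ((h.inter_XY y).1 ⟨hx, hy⟩)⟩

/-- Paths between different pieces. -/
theorem hamCount_across (h : Triangle adj X Y Z p q r) {u v : α} (hu : u ∈ X) (hv : v ∈ Y) :
    hamCount adj (X ∪ (Y ∪ Z)) u v = hamCount adj Z q r *
      (hamCount adj X u q * hamCount adj (Y \ {p}) r v +
        hamCount adj (X \ {p}) u q * hamCount adj Y r v) := by
  obtain ⟨hpX, hpY⟩ := (h.inter_XY p).2 rfl
  obtain ⟨hqX, hqZ⟩ := (h.inter_XZ q).2 rfl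
  obtain ⟨hrY, hrZ⟩ := (h.inter_YZ r).2 rfl
  have hqY : q ∉ Y := fun hq => h.ne_pq.symm ((h.inter_XY q).1 ⟨hqX, hq⟩)
  have hpZ : p ∉ Z := fun hp => h.ne_pq ((h.inter_XZ p).1 ⟨hpX, hp⟩)
  obtain ⟨y, hyY, hyp, hyr⟩ := h.exists_Y
  obtain ⟨z, hzZ, hzq, hzr⟩ := h.exists_Z
  have hyZ : y ∉ Z := fun hy => hyr ((h.inter_YZ y).1 ⟨hyY, hy⟩)
  have hzY : z ∉ Y := fun hz => hzr ((h.inter_YZ z).1 ⟨hz, hzZ⟩)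
  have hYZ : ∀ x ∈ Y, x ∈ Z → x = r := fun x hx hx' => (h.inter_YZ x).1 ⟨hx, hx'⟩
  rw [hamCount_two_cut h.separated_union h.eq_or_eq h.ne_pq h.not_adj
    (fun hqp => h.not_adj (h.symm _ _ hqp)) hpX (Or.inl hpY) hqX (Or.inr hqZ) h.exists_notMem hu
    (Or.inl hv)]
  have e1 : (Y ∪ Z) \ {q} = Y ∪ Z \ {q} := by
    rw [Set.union_sdiff_distrib, Set.sdiff_singleton_eq_self hqY]
  have e2 : (Y ∪ Z) \ {p} = Z ∪ Y \ {p} := by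
    rw [Set.union_sdiff_distrib, Set.sdiff_singleton_eq_self hpZ, Set.union_comm]
  have z1 : hamCount adj ((Y ∪ Z) \ {q}) p v = 0 := by
    rw [e1]
    refine hamCount_eq_zero_of_cut (p := r) ?_ (fun x hx hx' => hYZ x hx hx'.1)
      ⟨z, ⟨hzZ, hzq⟩, hzY⟩ hpY hv
    rintro x hx w ⟨hw, -⟩ hxw
    exact (h.sep_YZ x hx w hw hxw).imp_left fun hx' => ⟨hx', fun h => hqY (h ▸ hx)⟩
  have z2 : hamCount adj (Y ∪ Z) p v = 0 :=
    hamCount_eq_zero_of_cut h.sep_YZ hYZ ⟨z, hzZ, hzY⟩ hpY hv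
  have c1 : hamCount adj ((Y ∪ Z) \ {p}) q v =
      hamCount adj Z q r * hamCount adj (Y \ {p}) r v := by
    rw [e2]
    refine hamCount_cut ?_ (fun x hx hx' => hYZ x hx'.1 hx) hrZ ⟨hrY, h.ne_pr.symm⟩
      ⟨y, ⟨hyY, hyp⟩, hyZ⟩ hqZ
    rintro x hx w ⟨hw, -⟩ hxw
    exact (h.sep_YZ.symm x hx w hw hxw).imp_left fun hx' => ⟨hx', fun h => hpZ (h ▸ hx)⟩
  have c2 : hamCount adj (Y ∪ Z) q v = hamCount adj Z q r * hamCount adj Y r v := by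
    rw [Set.union_comm]
    exact hamCount_cut h.sep_YZ.symm (fun x hx hx' => hYZ x hx' hx) hrZ hrY ⟨y, hyY, hyZ⟩ hqZ
  rw [z1, z2, c1, c2]
  ring

/-- Paths with both ends in the same piece. -/
theorem hamCount_within (h : Triangle adj X Y Z p q r) {u v : α} (hu : u ∈ X) (hv : v ∈ X) :
    hamCount adj (X ∪ (Y ∪ Z)) u v =
      ((pathPairs adj X u p q v).ncard + (pathPairs adj X u q p v).ncard) *
        (hamCount adj Y p r * hamCount adj Z r q) := by
  obtain ⟨hpX, hpY⟩ := (h.inter_XY p).2 rfl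
  obtain ⟨hqX, hqZ⟩ := (h.inter_XZ q).2 rfl
  obtain ⟨hrY, hrZ⟩ := (h.inter_YZ r).2 rfl
  obtain ⟨z, hzZ, hzq, hzr⟩ := h.exists_Z
  rw [hamCount_detour h.separated_union h.eq_or_eq h.ne_pq hpX (Or.inl hpY) hqX (Or.inr hqZ)
    h.exists_notMem hu hv, hamCount_comm h.symm _ q p,
    hamCount_cut h.sep_YZ (fun x hx hx' => (h.inter_YZ x).1 ⟨hx, hx'⟩) hrY hrZ
      ⟨z, hzZ, fun hz => hzr ((h.inter_YZ z).1 ⟨hz, hzZ⟩)⟩ hpY]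
  ring

end Triangle

end HamLists

section Lattice

/-- The corners of the level-`n` gasket in the lattice coordinates `(i, j) ↦ i a₀ + j b₀`. -/
def corner (n : ℕ) : Fin 3 → ℕ × ℕ := ![(0, 0), (2 ^ n, 0), (0, 2 ^ n)]

/-- The vertices of `SG n` in lattice coordinates. -/
def verts : ℕ → Set (ℕ × ℕ)
  | 0 => Set.range (corner 0)
  | n + 1 => {x | ∃ i, ∃ y ∈ verts n, x = y + corner n i}

/-- The adjacency relation of `SG n` in lattice coordinates. -/
def edge : ℕ → ℕ × ℕ → ℕ × ℕ → Prop
  | 0 => fun x y => ∃ i j, i ≠ j ∧ x = corner 0 i ∧ y = corner 0 j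
  | n + 1 => fun x y => ∃ i, ∃ x' y', edge n x' y' ∧ x = x' + corner n i ∧ y = y' + corner n i

theorem corner_succ (n : ℕ) (i : Fin 3) : corner (n + 1) i = corner n i + corner n i := by
  fin_cases i <;> simp [corner, pow_succ, mul_two]

theorem corner_injective (n : ℕ) : Function.Injective (corner n) := by
  have := Nat.two_pow_pos n
  intro i j h
  fin_cases i <;> fin_cases j <;> simp [corner] at h ⊢ <;> omega

theorem corner_zero_mem_verts_zero (i : Fin 3) : corner 0 i ∈ verts 0 := ⟨i, rfl⟩

theorem corner_mem_verts : ∀ (n : ℕ) (i : Fin 3), corner n i ∈ verts n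
  | 0, i => corner_zero_mem_verts_zero i
  | n + 1, i => ⟨i, corner n i, corner_mem_verts n i, corner_succ n i⟩

theorem add_le_of_mem_verts : ∀ {n : ℕ} {x : ℕ × ℕ}, x ∈ verts n → x.1 + x.2 ≤ 2 ^ n
  | 0, _, ⟨i, hi⟩ => by subst hi; fin_cases i <;> simp [corner]
  | n + 1, _, ⟨i, y, hy, hx⟩ => by
    have := add_le_of_mem_verts hy
    subst hx
    fin_cases i <;> simp [corner] <;> omega

theorem edge_mem_verts : ∀ {n : ℕ} {x y : ℕ × ℕ}, edge n x y → x ∈ verts n ∧ y ∈ verts n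
  | 0, _, _, ⟨i, j, _, hx, hy⟩ => ⟨⟨i, hx.symm⟩, ⟨j, hy.symm⟩⟩
  | _ + 1, _, _, ⟨i, x', y', h, hx, hy⟩ =>
    ⟨⟨i, x', (edge_mem_verts h).1, hx⟩, ⟨i, y', (edge_mem_verts h).2, hy⟩⟩

theorem edge_symm : ∀ {n : ℕ} {x y : ℕ × ℕ}, edge n x y → edge n y x
  | 0, _, _, ⟨i, j, hij, hx, hy⟩ => ⟨j, i, hij.symm, hy, hx⟩
  | _ + 1, _, _, ⟨i, x', y', h, hx, hy⟩ => ⟨i, y', x', edge_symm h, hy, hx⟩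

theorem edge_ne : ∀ {n : ℕ} {x y : ℕ × ℕ}, edge n x y → x ≠ y
  | 0, _, _, ⟨i, j, hij, hx, hy⟩ => by
    subst hx hy
    exact (corner_injective 0).ne hij
  | _ + 1, _, _, ⟨i, x', y', h, hx, hy⟩ => by
    subst hx hy
    exact fun he => edge_ne h (add_right_cancel he)

theorem edge_le : ∀ {n : ℕ} {x y : ℕ × ℕ}, edge n x y → x.1 ≤ y.1 + 1 ∧ x.2 ≤ y.2 + 1
  | 0, _, _, ⟨i, j, _, hx, hy⟩ => by
    subst hx hy
    fin_cases i <;> fin_cases j <;> simp [corner]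
  | _ + 1, _, _, ⟨i, x', y', h, hx, hy⟩ => by
    have := edge_le h
    subst hx hy
    simp only [Prod.fst_add, Prod.snd_add]
    omega

theorem not_edge_corner {n : ℕ} (hn : 1 ≤ n) (i j : Fin 3) :
    ¬ edge n (corner n i) (corner n j) := by
  intro h
  have h1 := edge_le h
  have h2 := edge_le (edge_symm h)
  have h3 := edge_ne h
  have h4 : 2 ^ 1 ≤ 2 ^ n := Nat.pow_le_pow_right (by norm_num) hn
  fin_cases i <;> fin_cases j <;> simp [corner] at h1 h2 h3 <;> omega

/-- The `i`-th copy of the level-`n` gasket inside of the level-`n + 1` gasket. -/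
def copy (n : ℕ) (i : Fin 3) (S : Set (ℕ × ℕ)) : Set (ℕ × ℕ) := (· + corner n i) '' S

theorem add_mem_copy {n : ℕ} {i : Fin 3} {S : Set (ℕ × ℕ)} {x : ℕ × ℕ} :
    x + corner n i ∈ copy n i S ↔ x ∈ S :=
  (add_left_injective (corner n i)).mem_set_image

theorem eq_of_add_corner_eq {n : ℕ} {i j : Fin 3} (hij : i ≠ j) {x y : ℕ × ℕ}
    (hx : x ∈ verts n) (hy : y ∈ verts n) (h : x + corner n i = y + corner n j) :
    x = corner n j ∧ y = corner n i := by
  have h1 := add_le_of_mem_verts hx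
  have h2 := add_le_of_mem_verts hy
  obtain ⟨x1, x2⟩ := x
  obtain ⟨y1, y2⟩ := y
  have := Nat.two_pow_pos n
  fin_cases i <;> fin_cases j <;> simp [corner] at h h1 h2 hij ⊢ <;> omega

theorem edge_succ_add {n : ℕ} {i : Fin 3} {x y : ℕ × ℕ} (hx : x ∈ verts n) (hy : y ∈ verts n) :
    edge (n + 1) (x + corner n i) (y + corner n i) ↔ edge n x y := by
  refine ⟨?_, fun h => ⟨i, x, y, h, rfl, rfl⟩⟩
  rintro ⟨j, x', y', h, hx', hy'⟩
  obtain ⟨hx'', hy''⟩ := edge_mem_verts h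
  by_cases hij : i = j
  · subst hij
    rwa [add_right_cancel hx', add_right_cancel hy']
  · have h1 := (eq_of_add_corner_eq hij hx hx'' hx').2
    have h2 := (eq_of_add_corner_eq hij hy hy'' hy').2
    exact absurd (h1.trans h2.symm) (edge_ne h)

theorem hamCount_copy {n : ℕ} {i : Fin 3} {S : Set (ℕ × ℕ)} (hS : S ⊆ verts n) (u v : ℕ × ℕ) :
    hamCount (edge (n + 1)) (copy n i S) (u + corner n i) (v + corner n i) =
      hamCount (edge n) S u v :=
  hamCount_image (add_left_injective _) (fun _ hx _ hy => edge_succ_add (hS hx) (hS hy)) u v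

/-- The vertices of `SG n` other than the corners with index in `D`. -/
def vertsDel (n : ℕ) (D : Set (Fin 3)) : Set (ℕ × ℕ) := verts n \ corner n '' D

theorem vertsDel_subset (n : ℕ) (D : Set (Fin 3)) : vertsDel n D ⊆ verts n := Set.sdiff_subset

theorem vertsDel_empty (n : ℕ) : vertsDel n ∅ = verts n := by simp [vertsDel]

theorem corner_mem_vertsDel {n : ℕ} {D : Set (Fin 3)} {i : Fin 3} :
    corner n i ∈ vertsDel n D ↔ i ∉ D := by
  simp [vertsDel, corner_mem_verts, (corner_injective n).mem_set_image]

theorem vertsDel_diff (n : ℕ) (D : Set (Fin 3)) (i : Fin 3) :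
    vertsDel n D \ {corner n i} = vertsDel n (insert i D) := by
  rw [vertsDel, vertsDel, Set.image_insert_eq, Set.sdiff_sdiff, Set.union_singleton]

/-- The number of Hamiltonian paths from the `i`-th corner to `x` in `SG n` without the corners
in `D`. -/
def count (n : ℕ) (D : Set (Fin 3)) (i : Fin 3) (x : ℕ × ℕ) : ℕ :=
  hamCount (edge n) (vertsDel n D) (corner n i) x

theorem one_mem_verts : ∀ n, (1, 0) ∈ verts n
  | 0 => ⟨1, rfl⟩
  | n + 1 => ⟨0, (1, 0), one_mem_verts n, by simp [corner]⟩

theorem exists_mem_vertsDel {n : ℕ} (hn : 1 ≤ n) (D : Set (Fin 3)) :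
    ∃ x ∈ vertsDel n D, ∀ i, x ≠ corner n i := by
  have h2 : 2 ^ 1 ≤ 2 ^ n := Nat.pow_le_pow_right (by norm_num) hn
  have h : ∀ i, ((1, 0) : ℕ × ℕ) ≠ corner n i := fun i => by
    fin_cases i <;> simp [corner]
    omega
  refine ⟨(1, 0), ⟨one_mem_verts n, ?_⟩, h⟩
  rintro ⟨i, -, hi⟩
  exact h i hi.symm

theorem mem_copy_inter {n : ℕ} (D : Set (Fin 3)) {i j : Fin 3} (hij : i ≠ j) (x : ℕ × ℕ) :
    x ∈ copy n i (vertsDel n (D ∩ {i})) ∧ x ∈ copy n j (vertsDel n (D ∩ {j})) ↔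
      x = corner n i + corner n j := by
  constructor
  · rintro ⟨⟨y, hy, rfl⟩, ⟨z, hz, hyz⟩⟩
    simp only at hyz ⊢
    rw [(eq_of_add_corner_eq hij hy.1 hz.1 hyz.symm).1, add_comm]
  · rintro rfl
    rw [add_mem_copy, add_comm, add_mem_copy, corner_mem_vertsDel, corner_mem_vertsDel]
    simp [hij, hij.symm]

theorem separated_copy {n : ℕ} (hn : 1 ≤ n) (D : Set (Fin 3)) {i j : Fin 3} (hij : i ≠ j) :
    Separated (edge (n + 1)) (copy n i (vertsDel n (D ∩ {i})))
      (copy n j (vertsDel n (D ∩ {j}))) := by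
  intro x hx y hy hxy
  replace hxy : edge (n + 1) x y := hxy.elim id edge_symm
  obtain ⟨x', hx', rfl⟩ := hx
  obtain ⟨y', hy', rfl⟩ := hy
  obtain ⟨m, x'', y'', h, hxm, hym⟩ := hxy
  obtain ⟨hx'', hy''⟩ := edge_mem_verts h
  simp only at hxm hym ⊢
  by_cases him : i = m
  · subst him
    right
    rw [hym, add_mem_copy, (eq_of_add_corner_eq hij.symm hy'.1 hy'' hym).2, corner_mem_vertsDel]
    simp [hij.symm]
  by_cases hjm : j = m
  · subst hjm
    left
    rw [hxm, add_mem_copy, (eq_of_add_corner_eq hij hx'.1 hx'' hxm).2, corner_mem_vertsDel]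
    simp [hij]
  · rw [(eq_of_add_corner_eq him hx'.1 hx'' hxm).2, (eq_of_add_corner_eq hjm hy'.1 hy'' hym).2] at h
    exact absurd h (not_edge_corner hn i j)

theorem triangle {n : ℕ} (hn : 1 ≤ n) (D : Set (Fin 3)) {i j k : Fin 3} (hij : i ≠ j)
    (hik : i ≠ k) (hjk : j ≠ k) :
    Triangle (edge (n + 1)) (copy n i (vertsDel n (D ∩ {i}))) (copy n j (vertsDel n (D ∩ {j})))
      (copy n k (vertsDel n (D ∩ {k}))) (corner n i + corner n j) (corner n i + corner n k)
      (corner n j + corner n k) where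
  symm _ _ := edge_symm
  not_adj := by
    rw [add_comm (corner n i) (corner n j), add_comm (corner n i) (corner n k),
      edge_succ_add (corner_mem_verts n j) (corner_mem_verts n k)]
    exact not_edge_corner hn j k
  ne_pq h := hjk (corner_injective n (add_left_cancel h))
  ne_pr h := hik (corner_injective n (add_right_cancel (h.trans (add_comm _ _))))
  ne_qr h := hij (corner_injective n (add_right_cancel h))
  sep_XY := separated_copy hn D hij
  sep_XZ := separated_copy hn D hik
  sep_YZ := separated_copy hn D hjk
  inter_XY := mem_copy_inter D hij
  inter_XZ := mem_copy_inter D hik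
  inter_YZ := mem_copy_inter D hjk
  exists_Y := by
    obtain ⟨x, hx, hxc⟩ := exists_mem_vertsDel hn (D ∩ {j})
    refine ⟨x + corner n j, add_mem_copy.2 hx, fun h => hxc i (add_right_cancel h), fun h => ?_⟩
    exact hxc k (add_right_cancel (h.trans (add_comm _ _)))
  exists_Z := by
    obtain ⟨x, hx, hxc⟩ := exists_mem_vertsDel hn (D ∩ {k})
    exact ⟨x + corner n k, add_mem_copy.2 hx, fun h => hxc i (add_right_cancel h),
      fun h => hxc j (add_right_cancel h)⟩

theorem fin_three_eq_or {i j k : Fin 3} (hij : i ≠ j) (hik : i ≠ k) (hjk : j ≠ k) (m : Fin 3) :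
    m = i ∨ m = j ∨ m = k := by
  omega

theorem add_corner_eq_corner_succ {n : ℕ} {i j : Fin 3} {x : ℕ × ℕ} (hx : x ∈ verts n) :
    x + corner n i = corner (n + 1) j ↔ i = j ∧ x = corner n j := by
  rw [corner_succ]
  constructor
  · intro h
    by_cases hij : i = j
    · subst hij
      exact ⟨rfl, add_right_cancel h⟩
    · exact absurd (corner_injective n (eq_of_add_corner_eq hij hx (corner_mem_verts n j) h).2)
        (Ne.symm hij)
  · rintro ⟨rfl, rfl⟩
    rfl

theorem vertsDel_succ (n : ℕ) (D : Set (Fin 3)) {i j k : Fin 3} (hij : i ≠ j)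
    (hik : i ≠ k) (hjk : j ≠ k) :
    vertsDel (n + 1) D = copy n i (vertsDel n (D ∩ {i})) ∪
      (copy n j (vertsDel n (D ∩ {j})) ∪ copy n k (vertsDel n (D ∩ {k}))) := by
  have key : ∀ x, x ∈ vertsDel (n + 1) D ↔ ∃ m, x ∈ copy n m (vertsDel n (D ∩ {m})) := by
    intro x
    constructor
    · rintro ⟨⟨m, y, hy, rfl⟩, hD⟩
      refine ⟨m, add_mem_copy.2 ⟨hy, ?_⟩⟩
      rintro ⟨d, ⟨hd, hdm⟩, rfl⟩
      rw [Set.mem_singleton_iff] at hdm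
      subst hdm
      exact hD ⟨d, hd, corner_succ n d⟩
    · rintro ⟨m, y, ⟨hy, hD⟩, rfl⟩
      refine ⟨⟨m, y, hy, rfl⟩, ?_⟩
      rintro ⟨d, hd, hdm⟩
      obtain ⟨rfl, rfl⟩ := (add_corner_eq_corner_succ hy).1 hdm.symm
      exact hD ⟨m, ⟨hd, rfl⟩, rfl⟩
  ext x
  rw [key, Set.mem_union, Set.mem_union]
  constructor
  · rintro ⟨m, hm⟩
    rcases fin_three_eq_or hij hik hjk m with rfl | rfl | rfl <;> tauto
  · rintro (h | h | h)
    exacts [⟨i, h⟩, ⟨j, h⟩, ⟨k, h⟩]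

theorem copy_diff (n : ℕ) (i j : Fin 3) (S : Set (ℕ × ℕ)) :
    copy n j S \ {corner n i + corner n j} = copy n j (S \ {corner n i}) := by
  rw [copy, copy, Set.image_sdiff (add_left_injective _), Set.image_singleton]

/-- Recursion for the paths ending in another copy than the one they start in. -/
theorem count_succ_across {n : ℕ} (hn : 1 ≤ n) {D : Set (Fin 3)} {i j k : Fin 3} (hij : i ≠ j)
    (hik : i ≠ k) (hjk : j ≠ k) (hi : i ∉ D) {x : ℕ × ℕ} (hx : x ∈ verts n) :
    count (n + 1) D i (x + corner n j) = count n (D ∩ {k}) i (corner n j) *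
      (count n ∅ i (corner n k) * count n (insert i (D ∩ {j})) k x +
        count n {j} i (corner n k) * count n (D ∩ {j}) k x) := by
  have hiD : D ∩ {i} = ∅ := by simpa using hi
  by_cases hxD : x ∈ vertsDel n (D ∩ {j})
  · have hY : copy n j (vertsDel n (D ∩ {j})) \ {corner n i + corner n j} =
        copy n j (vertsDel n (insert i (D ∩ {j}))) := by rw [copy_diff, vertsDel_diff]
    have hX : copy n i (vertsDel n ∅) \ {corner n i + corner n j} =
        copy n i (vertsDel n {j}) := by
      rw [add_comm, copy_diff, vertsDel_diff, insert_empty_eq]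
    rw [count, vertsDel_succ n D hij hik hjk, corner_succ,
      (triangle hn D hij hik hjk).hamCount_across _ (add_mem_copy.2 hxD), hY, hiD, hX,
      hamCount_copy (vertsDel_subset _ _), add_comm (corner n i) (corner n k),
      add_comm (corner n j) (corner n k)]
    · simp only [hamCount_copy (vertsDel_subset _ _)]
      rfl
    · rw [add_mem_copy, corner_mem_vertsDel]
      simp [hiD]
  · have h1 : x + corner n j ∉ vertsDel (n + 1) D := by
      obtain ⟨d, ⟨hd, rfl⟩, rfl⟩ : x ∈ corner n '' (D ∩ {j}) := by
        by_contra h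
        exact hxD ⟨hx, h⟩
      rw [← corner_succ, corner_mem_vertsDel]
      exact not_not_intro hd
    have h2 : x ∉ vertsDel n (insert i (D ∩ {j})) := fun h => hxD ⟨h.1, fun h' =>
      h.2 (Set.image_mono (Set.subset_insert _ _) h')⟩
    have h0 : ∀ {m D' l y}, y ∉ vertsDel m D' → count m D' l y = 0 := fun h =>
      hamCount_eq_zero_of_notMem (.inr h)
    rw [h0 h1, h0 h2, h0 hxD, mul_zero, mul_zero, add_zero, mul_zero]

/-- Recursion for the paths ending in the copy they start in. -/
theorem exists_count_succ_within {n : ℕ} (hn : 1 ≤ n) {i j k : Fin 3} (hij : i ≠ j)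
    (hik : i ≠ k) (hjk : j ≠ k) {x : ℕ × ℕ} (hx : x ∈ verts n) :
    ∃ h, ∀ D : Set (Fin 3), i ∉ D → count (n + 1) D i (x + corner n i) =
      h * (count n (D ∩ {j}) i (corner n k) * count n (D ∩ {k}) j (corner n i)) := by
  refine ⟨(pathPairs (edge (n + 1)) (copy n i (vertsDel n ∅)) (corner n i + corner n i)
    (corner n i + corner n j) (corner n i + corner n k) (x + corner n i)).ncard +
    (pathPairs (edge (n + 1)) (copy n i (vertsDel n ∅)) (corner n i + corner n i)
    (corner n i + corner n k) (corner n i + corner n j) (x + corner n i)).ncard, fun D hi => ?_⟩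
  have hiD : D ∩ {i} = ∅ := by simpa using hi
  rw [count, vertsDel_succ n D hij hik hjk, corner_succ,
    (triangle hn D hij hik hjk).hamCount_within, hiD, add_comm (corner n j) (corner n k),
    hamCount_copy (vertsDel_subset _ _), add_comm (corner n k) (corner n j),
    hamCount_copy (vertsDel_subset _ _)]
  · rfl
  · rw [add_mem_copy, corner_mem_vertsDel]
    simp [hiD]
  · rw [add_mem_copy, hiD, vertsDel_empty]
    exact hx

/-- All simple paths of length `k` of `adj` from `u` to `v` through the points of `S`. -/
def pathList {α : Type*} [DecidableEq α] (adj : α → α → Bool) (v : α) :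
    ℕ → List α → α → List (List α)
  | 0, _, u => if u = v then [[u]] else []
  | k + 1, S, u =>
    (S.filter (adj u)).flatMap fun w => (pathList adj v k (S.erase w) w).map (u :: ·)

theorem mem_pathList {α : Type*} [DecidableEq α] {adj : α → α → Bool} {v : α} :
    ∀ {k : ℕ} {S : List α} {u : α} {l : List α}, (u :: S).Nodup → S.length = k →
      (l ∈ pathList adj v k S u ↔
        l ∈ hamLists (fun x y => adj x y = true) {x | x ∈ u :: S} u v)
  | 0, S, u, l, hS, hk => by
    obtain rfl := List.length_eq_zero_iff.1 hk
    constructor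
    · intro h
      rw [pathList] at h
      split_ifs at h with huv
      · subst huv
        obtain rfl := List.mem_singleton.1 h
        simp [hamLists]
      · simp at h
    · rintro ⟨h1, h2, h3, h4, h5⟩
      obtain ⟨t, rfl⟩ := List.head?_eq_some_iff.1 h3
      cases t with
      | nil =>
        have : u = v := by simpa using h4
        simp [pathList, this]
      | cons w t =>
        have : w = u := by simpa using (h5 w).1 (by simp)
        simp [this] at h1
  | k + 1, S, u, l, hS, hk => by
    have hS' := List.nodup_cons.1 hS
    have ih : ∀ w ∈ S, ∀ m, m ∈ pathList adj v k (S.erase w) w ↔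
        m ∈ hamLists (fun x y => adj x y = true) {x | x ∈ S} w v := fun w hw m => by
      have hp := List.perm_cons_erase hw
      rw [mem_pathList (hp.nodup hS'.2) (by rw [List.length_erase_of_mem hw, hk]; rfl)]
      simp only [hp.mem_iff.symm]
    rw [pathList, List.mem_flatMap]
    constructor
    · rintro ⟨w, hw, hl⟩
      obtain ⟨hw, hadj⟩ := List.mem_filter.1 hw
      obtain ⟨m, hm, rfl⟩ := List.mem_map.1 hl
      obtain ⟨h1, h2, h3, h4, h5⟩ := (ih w hw m).1 hm
      obtain ⟨t, rfl⟩ := List.head?_eq_some_iff.1 h3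
      refine ⟨List.nodup_cons.2 ⟨fun h => hS'.1 ((h5 u).1 h), h1⟩,
        List.isChain_cons_cons.2 ⟨hadj, h2⟩, rfl, by simpa using h4, fun x => ?_⟩
      have := h5 x
      simp only [Set.mem_ofPred_eq, List.mem_cons] at this ⊢
      rw [this]
    · rintro ⟨h1, h2, h3, h4, h5⟩
      obtain ⟨t, rfl⟩ := List.head?_eq_some_iff.1 h3
      have ht : ∀ x, x ∈ t ↔ x ∈ S := fun x => by
        have := h5 x
        have hu := (List.nodup_cons.1 h1).1
        simp only [Set.mem_ofPred_eq, List.mem_cons] at this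
        constructor <;> intro hx
        · exact (this.1 (.inr hx)).resolve_left fun h => hu (h ▸ hx)
        · exact (this.2 (.inr hx)).resolve_left fun h => hS'.1 (h ▸ hx)
      cases t with
      | nil =>
        cases S with
        | nil => simp at hk
        | cons s S => simpa using (ht s).2 (by simp)
      | cons w t =>
        obtain ⟨hadj, h2⟩ := List.isChain_cons_cons.1 h2
        have hw := (ht w).1 (by simp)
        exact ⟨w, List.mem_filter.2 ⟨hw, hadj⟩, List.mem_map.2 ⟨w :: t, (ih w hw _).2
          ⟨(List.nodup_cons.1 h1).2, h2, rfl, by simpa using h4, ht⟩, rfl⟩⟩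

theorem hamCount_eq_card_pathList {α : Type*} [DecidableEq α] {adj : α → α → Bool} {S : List α}
    {u : α} (hS : (u :: S).Nodup) (v : α) :
    hamCount (fun x y => adj x y = true) {x | x ∈ u :: S} u v =
      (pathList adj v S.length S u).toFinset.card := by
  rw [hamCount, ← Set.ncard_coe_finset]
  congr 1
  ext l
  rw [Finset.mem_coe, List.mem_toFinset, mem_pathList hS rfl]

/-- The vertices of `SG 1`. -/
def vertsOne : List (ℕ × ℕ) := [(0, 0), (2, 0), (0, 2), (1, 0), (0, 1), (1, 1)]

/-- The adjacency relation of `SG 1`. -/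
def edgeOne (x y : ℕ × ℕ) : Bool :=
  x.1 + 1 = y.1 && x.2 = y.2 || y.1 + 1 = x.1 && x.2 = y.2 ||
  x.2 + 1 = y.2 && x.1 = y.1 || y.2 + 1 = x.2 && x.1 = y.1 ||
  x.1 + 1 = y.1 && y.2 + 1 = x.2 || y.1 + 1 = x.1 && x.2 + 1 = y.2

theorem mem_verts_one (x : ℕ × ℕ) : x ∈ verts 1 ↔ x ∈ vertsOne := by
  constructor
  · rintro ⟨i, _, ⟨j, rfl⟩, rfl⟩
    fin_cases i <;> fin_cases j <;> simp [corner, vertsOne]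
  · intro h
    have key : ∀ x ∈ vertsOne, ∃ i j, x = corner 0 j + corner 0 i := by decide
    obtain ⟨i, j, rfl⟩ := key x h
    exact ⟨i, _, ⟨j, rfl⟩, rfl⟩

theorem edge_one {x y : ℕ × ℕ} (hx : x ∈ verts 1) (hy : y ∈ verts 1) :
    edge 1 x y ↔ edgeOne x y = true := by
  have key : ∀ x ∈ vertsOne, ∀ y ∈ vertsOne, (∃ m i j, (i ≠ j ∧
      x = corner 0 i + corner 0 m ∧ y = corner 0 j + corner 0 m)) ↔ edgeOne x y = true := by
    decide
  rw [← key x ((mem_verts_one x).1 hx) y ((mem_verts_one y).1 hy)]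
  constructor
  · rintro ⟨m, _, _, ⟨i, j, hij, rfl, rfl⟩, hx, hy⟩
    exact ⟨m, i, j, hij, hx, hy⟩
  · rintro ⟨m, i, j, hij, hx, hy⟩
    exact ⟨m, _, _, ⟨i, j, hij, rfl, rfl⟩, hx, hy⟩

theorem count_one (D : Finset (Fin 3)) {i : Fin 3} (hi : i ∉ D) (x : ℕ × ℕ) :
    count 1 D i x = (pathList edgeOne x (5 - D.card)
      ((vertsOne.filter (· ∉ D.image (corner 1))).erase (corner 1 i))
      (corner 1 i)).toFinset.card := by
  have hn : ∀ (D : Finset (Fin 3)) i, i ∉ D → (corner 1 i ::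
      (vertsOne.filter (· ∉ D.image (corner 1))).erase (corner 1 i)).Nodup ∧
      ((vertsOne.filter (· ∉ D.image (corner 1))).erase (corner 1 i)).length = 5 - D.card ∧
      corner 1 i ∈ vertsOne.filter (· ∉ D.image (corner 1)) := by
    decide
  obtain ⟨h1, h2, h3⟩ := hn D i hi
  rw [← h2, ← hamCount_eq_card_pathList h1, count,
    hamCount_congr fun x hx y hy => edge_one (vertsDel_subset 1 D hx) (vertsDel_subset 1 D hy)]
  congr 1
  ext y
  rw [Set.mem_ofPred_eq, ← (List.perm_cons_erase h3).mem_iff, vertsDel, Set.mem_sdiff,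
    mem_verts_one, List.mem_filter]
  simp

theorem count_one_empty : ∀ {i j k : Fin 3}, i ≠ j → i ≠ k → j ≠ k →
    count 1 ∅ i (corner 1 i) = 0 ∧ count 1 ∅ i (corner 1 j) = 2 ∧
      count 1 ∅ i (corner 0 i + corner 0 j) = 1 ∧ count 1 ∅ i (corner 0 j + corner 0 k) = 0 := by
  intro i j k
  have h := fun x => count_one (i := i) ∅ (by simp) x
  rw [Finset.coe_empty] at h
  simp only [h]
  clear h
  revert i j k
  decide

theorem count_one_singleton : ∀ {i j k : Fin 3}, i ≠ j → i ≠ k → j ≠ k →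
    count 1 {k} i (corner 1 i) = 0 ∧ count 1 {k} i (corner 1 j) = 3 ∧
      count 1 {k} i (corner 0 i + corner 0 j) = 1 ∧ count 1 {k} i (corner 0 i + corner 0 k) = 1 ∧
      count 1 {k} i (corner 0 j + corner 0 k) = 1 ∧ count 1 {k} i (corner 1 k) = 0 := by
  intro i j k hij hik hjk
  have h := fun x => count_one (i := i) {k} (by simpa using hik) x
  rw [Finset.coe_singleton] at h
  simp only [h]
  clear h
  revert i j k
  decide

theorem count_one_pair : ∀ {i j k : Fin 3}, i ≠ j → i ≠ k → j ≠ k →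
    count 1 {j, k} i (corner 1 i) = 0 ∧ count 1 {j, k} i (corner 1 j) = 0 ∧
      count 1 {j, k} i (corner 0 i + corner 0 j) = 1 ∧
      count 1 {j, k} i (corner 0 j + corner 0 k) = 2 := by
  intro i j k hij hik hjk
  have h := fun x => count_one (i := i) {j, k} (by simpa using ⟨hij, hik⟩) x
  rw [Finset.coe_insert, Finset.coe_singleton] at h
  simp only [h]
  clear h
  revert i j k
  decide

/-- The number of Hamiltonian paths between two given corners of `SG n`. -/
def cornerCount (n : ℕ) : ℕ := count n ∅ 0 (corner n 1)

/-- The number of Hamiltonian paths between two given corners of `SG n` without the third one. -/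
def cornerCountDel (n : ℕ) : ℕ := count n {2} 0 (corner n 1)

theorem exists_ne_and_ne {i j : Fin 3} (hij : i ≠ j) : ∃ k, i ≠ k ∧ j ≠ k := by
  revert i j
  decide

theorem singleton_inter_singleton_of_ne {i j : Fin 3} (h : i ≠ j) :
    ({i} : Set (Fin 3)) ∩ {j} = ∅ := by
  simpa using h.symm

theorem count_corner_succ {n N M : ℕ} (hn : 1 ≤ n)
    (h : ∀ {i j k : Fin 3}, i ≠ j → i ≠ k → j ≠ k →
      count n ∅ i (corner n j) = N ∧ count n {k} i (corner n j) = M)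
    {i j k : Fin 3} (hij : i ≠ j) (hik : i ≠ k) (hjk : j ≠ k) :
    count (n + 1) ∅ i (corner (n + 1) j) = 2 * N ^ 2 * M ∧
      count (n + 1) {k} i (corner (n + 1) j) = 2 * N * M ^ 2 := by
  rw [corner_succ, count_succ_across hn hij hik hjk (Set.notMem_empty i) (corner_mem_verts n j),
    count_succ_across hn hij hik hjk (by simpa using hik) (corner_mem_verts n j),
    Set.empty_inter, Set.empty_inter, Set.inter_self, singleton_inter_singleton_of_ne hjk.symm,
    insert_empty_eq, (h hij hik hjk).1, (h hij hik hjk).2, (h hik hij hjk.symm).1,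
    (h hik hij hjk.symm).2, (h hjk.symm hik.symm hij.symm).1, (h hjk.symm hik.symm hij.symm).2]
  constructor <;> ring

theorem count_corner_and {n : ℕ} (hn : 1 ≤ n) : ∀ {i j k : Fin 3}, i ≠ j → i ≠ k → j ≠ k →
    count n ∅ i (corner n j) = cornerCount n ∧ count n {k} i (corner n j) = cornerCountDel n := by
  suffices ∃ N M, ∀ {i j k : Fin 3}, i ≠ j → i ≠ k → j ≠ k →
      count n ∅ i (corner n j) = N ∧ count n {k} i (corner n j) = M by
    obtain ⟨N, M, h⟩ := this
    have h012 := h (i := 0) (j := 1) (k := 2) (by decide) (by decide) (by decide)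
    rwa [cornerCount, cornerCountDel, h012.1, h012.2]
  induction n, hn using Nat.le_induction with
  | base =>
    exact ⟨2, 3, fun hij hik hjk =>
      ⟨(count_one_empty hij hik hjk).2.1, (count_one_singleton hij hik hjk).2.1⟩⟩
  | succ n hn ih =>
    obtain ⟨N, M, h⟩ := ih
    exact ⟨_, _, count_corner_succ hn h⟩

theorem count_corner {n : ℕ} (hn : 1 ≤ n) {i j : Fin 3} (hij : i ≠ j) :
    count n ∅ i (corner n j) = cornerCount n := by
  obtain ⟨k, hik, hjk⟩ := exists_ne_and_ne hij
  exact (count_corner_and hn hij hik hjk).1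

theorem count_corner_del {n : ℕ} (hn : 1 ≤ n) {i j k : Fin 3} (hij : i ≠ j) (hik : i ≠ k)
    (hjk : j ≠ k) : count n {k} i (corner n j) = cornerCountDel n :=
  (count_corner_and hn hij hik hjk).2

theorem cornerCount_one : cornerCount 1 = 2 :=
  (count_one_empty (i := 0) (j := 1) (k := 2) (by decide) (by decide) (by decide)).2.1

theorem cornerCountDel_one : cornerCountDel 1 = 3 :=
  (count_one_singleton (i := 0) (j := 1) (k := 2) (by decide) (by decide) (by decide)).2.1

theorem cornerCount_succ {n : ℕ} (hn : 1 ≤ n) :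
    cornerCount (n + 1) = 2 * cornerCount n ^ 2 * cornerCountDel n :=
  (count_corner_succ hn (count_corner_and hn) (i := 0) (j := 1) (k := 2) (by decide) (by decide)
    (by decide)).1

theorem cornerCountDel_succ {n : ℕ} (hn : 1 ≤ n) :
    cornerCountDel (n + 1) = 2 * cornerCount n * cornerCountDel n ^ 2 :=
  (count_corner_succ hn (count_corner_and hn) (i := 0) (j := 1) (k := 2) (by decide) (by decide)
    (by decide)).2

theorem cornerCount_pos {n : ℕ} (hn : 1 ≤ n) : 0 < cornerCount n ∧ 0 < cornerCountDel n := by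
  induction n, hn using Nat.le_induction with
  | base => simp [cornerCount_one, cornerCountDel_one]
  | succ n hn ih =>
    obtain ⟨h1, h2⟩ := ih
    rw [cornerCount_succ hn, cornerCountDel_succ hn]
    constructor <;> positivity

/-- The distribution ratio of the paths in `SG n` starting at the corner `i`. -/
def ratio (n : ℕ) (i : Fin 3) (x : ℕ × ℕ) : ℝ := count n ∅ i x / cornerCount n

/-- The distribution ratio of the paths starting at the corner `i` in `SG n` without the
corner `j`. -/
def ratioDel (n : ℕ) (i j : Fin 3) (x : ℕ × ℕ) : ℝ := count n {j} i x / cornerCountDel n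

/-- The distribution ratio of the paths starting at the corner `i` in `SG n` without the
corners `j` and `k`. -/
def ratioDelPair (n : ℕ) (i j k : Fin 3) (x : ℕ × ℕ) : ℝ :=
  count n {j, k} i x * cornerCount n / cornerCountDel n ^ 2

theorem ratioDelPair_comm (n : ℕ) (i j k : Fin 3) (x : ℕ × ℕ) :
    ratioDelPair n i j k x = ratioDelPair n i k j x := by
  rw [ratioDelPair, ratioDelPair, Set.pair_comm]

theorem ratio_succ_across {n : ℕ} (hn : 1 ≤ n) {i j k : Fin 3} (hij : i ≠ j) (hik : i ≠ k)
    (hjk : j ≠ k) {x : ℕ × ℕ} (hx : x ∈ verts n) :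
    ratio (n + 1) i (x + corner n j) = (ratioDel n k i x + ratio n k x) / 2 := by
  have hN := (cornerCount_pos hn).1
  have hM := (cornerCount_pos hn).2
  rw [ratio, ratio, ratioDel, count_succ_across hn hij hik hjk (Set.notMem_empty i) hx,
    cornerCount_succ hn, Set.empty_inter, Set.empty_inter, insert_empty_eq, count_corner hn hij,
    count_corner hn hik, count_corner_del hn hik hij hjk.symm]
  push_cast
  field_simp

theorem ratioDel_succ_across {n : ℕ} (hn : 1 ≤ n) {i j k : Fin 3} (hij : i ≠ j) (hik : i ≠ k)
    (hjk : j ≠ k) {x : ℕ × ℕ} (hx : x ∈ verts n) :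
    ratioDel (n + 1) i k (x + corner n j) = (ratioDel n k i x + ratio n k x) / 2 := by
  have hN := (cornerCount_pos hn).1
  have hM := (cornerCount_pos hn).2
  rw [ratio, ratioDel, ratioDel, count_succ_across hn hij hik hjk (by simpa using hik) hx,
    cornerCountDel_succ hn, Set.inter_self, singleton_inter_singleton_of_ne hjk.symm,
    insert_empty_eq, count_corner_del hn hij hik hjk, count_corner hn hik,
    count_corner_del hn hik hij hjk.symm]
  push_cast
  field_simp

theorem ratioDel_succ_across_self {n : ℕ} (hn : 1 ≤ n) {i j k : Fin 3} (hij : i ≠ j)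
    (hik : i ≠ k) (hjk : j ≠ k) {x : ℕ × ℕ} (hx : x ∈ verts n) :
    ratioDel (n + 1) i j (x + corner n j) = (ratioDelPair n k i j x + ratioDel n k j x) / 2 := by
  have hN := (cornerCount_pos hn).1
  have hM := (cornerCount_pos hn).2
  rw [ratioDelPair, ratioDel, ratioDel, count_succ_across hn hij hik hjk (by simpa using hij) hx,
    cornerCountDel_succ hn, Set.inter_self, singleton_inter_singleton_of_ne hjk,
    count_corner hn hij, count_corner hn hik, count_corner_del hn hik hij hjk.symm]
  push_cast
  field_simp

theorem ratioDelPair_succ_across {n : ℕ} (hn : 1 ≤ n) {i j k : Fin 3} (hij : i ≠ j)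
    (hik : i ≠ k) (hjk : j ≠ k) {x : ℕ × ℕ} (hx : x ∈ verts n) :
    ratioDelPair (n + 1) i j k (x + corner n j) = ratioDel (n + 1) i j (x + corner n j) := by
  have hN := (cornerCount_pos hn).1
  have hM := (cornerCount_pos hn).2
  have hj : ({j, k} : Set (Fin 3)) ∩ {j} = {j} := by simp
  have hk : ({j, k} : Set (Fin 3)) ∩ {k} = {k} := by simp
  rw [ratioDel_succ_across_self hn hij hik hjk hx, ratioDelPair, ratioDelPair, ratioDel,
    count_succ_across hn hij hik hjk (by simpa using ⟨hij, hik⟩) hx, cornerCount_succ hn,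
    cornerCountDel_succ hn, hj, hk, count_corner_del hn hij hik hjk, count_corner hn hik,
    count_corner_del hn hik hij hjk.symm]
  push_cast
  field_simp

theorem ratio_succ_within {n : ℕ} (hn : 1 ≤ n) {i j k : Fin 3} (hij : i ≠ j) (hik : i ≠ k)
    (hjk : j ≠ k) {x : ℕ × ℕ} (hx : x ∈ verts n) :
    ratio (n + 1) i (x + corner n i) = ratioDel (n + 1) i j (x + corner n i) ∧
      ratioDelPair (n + 1) i j k (x + corner n i) = ratioDel (n + 1) i j (x + corner n i) := by
  have hN := (cornerCount_pos hn).1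
  have hM := (cornerCount_pos hn).2
  obtain ⟨h, hh⟩ := exists_count_succ_within hn hij hik hjk hx
  have hj : ({j, k} : Set (Fin 3)) ∩ {j} = {j} := by simp
  have hk : ({j, k} : Set (Fin 3)) ∩ {k} = {k} := by simp
  rw [ratio, ratioDel, ratioDelPair, hh ∅ (by simp), hh {j} (by simpa using hij),
    hh {j, k} (by simpa using ⟨hij, hik⟩), cornerCount_succ hn, cornerCountDel_succ hn, hj, hk,
    Set.empty_inter, Set.empty_inter, Set.inter_self, singleton_inter_singleton_of_ne hjk,
    count_corner hn hik, count_corner hn hij.symm, count_corner_del hn hik hij hjk.symm,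
    count_corner_del hn hij.symm hjk hik]
  push_cast
  constructor <;> field_simp

theorem ratio_succ_eq_ratioDel {n : ℕ} (hn : 1 ≤ n) {i j l : Fin 3} (hij : i ≠ j) (hlj : l ≠ j)
    {x : ℕ × ℕ} (hx : x ∈ verts n) :
    ratio (n + 1) i (x + corner n l) = ratioDel (n + 1) i j (x + corner n l) := by
  obtain ⟨k, hik, hjk⟩ := exists_ne_and_ne hij
  by_cases hil : i = l
  · subst hil
    exact (ratio_succ_within hn hij hik hjk hx).1
  · rw [ratio_succ_across hn hil hij hlj hx, ratioDel_succ_across hn hil hij hlj hx]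

theorem ratioDelPair_succ_eq_ratioDel {n : ℕ} (hn : 1 ≤ n) {i j k l : Fin 3} (hij : i ≠ j)
    (hik : i ≠ k) (hjk : j ≠ k) (hlk : l ≠ k) {x : ℕ × ℕ} (hx : x ∈ verts n) :
    ratioDelPair (n + 1) i j k (x + corner n l) = ratioDel (n + 1) i j (x + corner n l) := by
  rcases fin_three_eq_or hij hik hjk l with rfl | rfl | rfl
  · exact (ratio_succ_within hn hij hik hjk hx).2
  · exact ratioDelPair_succ_across hn hij hik hjk hx
  · exact absurd rfl hlk

theorem ratio_eq_ratioDel_of_ne {n : ℕ} (hn : 1 ≤ n) {i j l : Fin 3} (hij : i ≠ j) (hlj : l ≠ j)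
    {x : ℕ × ℕ} (hx : x ∈ verts n) :
    ratio (n + 2) i (x + corner n l + corner (n + 1) j) =
      ratioDel (n + 2) i j (x + corner n l + corner (n + 1) j) := by
  obtain ⟨k, hik, hjk⟩ := exists_ne_and_ne hij
  have hx' : x + corner n l ∈ verts (n + 1) := ⟨l, x, hx, rfl⟩
  rw [ratio_succ_across (by omega) hij hik hjk hx',
    ratioDel_succ_across_self (by omega) hij hik hjk hx',
    ratio_succ_eq_ratioDel hn hjk.symm hlj hx,
    ratioDelPair_succ_eq_ratioDel hn hik.symm hjk.symm hij hlj hx]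

theorem ratio_add_corner_add_corner {n : ℕ} (hn : 1 ≤ n) {i j k : Fin 3} (hij : i ≠ j)
    (hik : i ≠ k) (hjk : j ≠ k) {x : ℕ × ℕ} (hx : x ∈ verts n) :
    ratio (n + 2) i (x + corner n j + corner (n + 1) j) = ratio (n + 1) k (x + corner n j) ∧
      ratioDel (n + 2) i j (x + corner n j + corner (n + 1) j) =
        ratioDel (n + 1) k j (x + corner n j) := by
  have hx' : x + corner n j ∈ verts (n + 1) := ⟨j, x, hx, rfl⟩
  rw [ratio_succ_across (by omega) hij hik hjk hx',
    ratioDel_succ_across_self (by omega) hij hik hjk hx',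
    ratio_succ_eq_ratioDel hn hik.symm hij.symm hx, ratioDelPair_comm,
    ratioDelPair_succ_eq_ratioDel hn hjk.symm hik.symm hij.symm hij.symm hx]
  constructor <;> ring

/-- For `s ≠ t` the vertices of the smallest lacunary triangle of `SG (n + 1)` next to the
corner `j`. -/
def lacunary (j s t : Fin 3) : ℕ → ℕ × ℕ
  | 0 => corner 0 s + corner 0 t
  | n + 1 => lacunary j s t n + corner (n + 1) j

theorem lacunary_comm (j s t : Fin 3) : ∀ n, lacunary j s t n = lacunary j t s n
  | 0 => add_comm _ _
  | n + 1 => congrArg (· + corner (n + 1) j) (lacunary_comm j s t n)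

theorem lacunary_mem_verts (j s t : Fin 3) : ∀ n, lacunary j s t n ∈ verts (n + 1)
  | 0 => ⟨t, corner 0 s, ⟨s, rfl⟩, rfl⟩
  | n + 1 => ⟨j, _, lacunary_mem_verts j s t n, rfl⟩

theorem exists_of_mem_verts_one {x : ℕ × ℕ} (hx : x ∈ verts 1) :
    (∃ i, x = corner 1 i) ∨ ∃ s t, s ≠ t ∧ x = corner 0 s + corner 0 t := by
  obtain ⟨i, _, ⟨j, rfl⟩, rfl⟩ := hx
  by_cases h : j = i
  · subst h
    exact .inl ⟨j, (corner_succ 0 j).symm⟩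
  · exact .inr ⟨j, i, h, rfl⟩

/-- The distribution ratios agree off the exceptional vertices. -/
theorem ratio_eq_ratioDel {i j : Fin 3} (hij : i ≠ j) (n : ℕ) {x : ℕ × ℕ} (hx : x ∈ verts (n + 2))
    (hxj : x ≠ corner (n + 2) j) (hxl : ∀ s t, s ≠ t → x ≠ lacunary j s t (n + 1)) :
    ratio (n + 2) i x = ratioDel (n + 2) i j x := by
  induction n generalizing i x with
  | zero =>
    obtain ⟨k, hik, hjk⟩ := exists_ne_and_ne hij
    obtain ⟨l, x, hx, rfl⟩ := hx
    by_cases hlj : l = j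
    · subst hlj
      rw [ratio_succ_across le_rfl hij hik hjk hx,
        ratioDel_succ_across_self le_rfl hij hik hjk hx, ratio, ratioDel, ratioDelPair, ratioDel]
      rcases exists_of_mem_verts_one hx with ⟨m, rfl⟩ | ⟨s, t, hst, rfl⟩
      · rcases fin_three_eq_or hij hik hjk m with rfl | rfl | rfl
        · rw [(count_one_singleton hjk.symm hik.symm hij.symm).2.2.2.2.2,
            (count_one_empty hik.symm hjk.symm hij).2.1,
            (count_one_pair hik.symm hjk.symm hij).2.1,
            (count_one_singleton hik.symm hjk.symm hij).2.1, cornerCount_one, cornerCountDel_one]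
          norm_num
        · exact absurd (corner_succ 1 m).symm hxj
        · rw [(count_one_singleton hjk.symm hik.symm hij.symm).1,
            (count_one_empty hik.symm hjk.symm hij).1,
            (count_one_pair hik.symm hjk.symm hij).1,
            (count_one_singleton hik.symm hjk.symm hij).1]
          norm_num
      · exact absurd rfl (hxl s t hst)
    · exact ratio_succ_eq_ratioDel le_rfl hij hlj hx
  | succ n ih =>
    obtain ⟨k, hik, hjk⟩ := exists_ne_and_ne hij
    obtain ⟨l, x, hx, rfl⟩ := hx
    by_cases hlj : l = j
    · subst hlj
      obtain ⟨l', x, hx', rfl⟩ := id hx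
      by_cases hlj' : l' = l
      · subst hlj'
        rw [(ratio_add_corner_add_corner (by omega) hij hik hjk hx').1,
          (ratio_add_corner_add_corner (by omega) hij hik hjk hx').2]
        refine ih hjk.symm hx (fun h => hxj ?_) fun s t hst h => hxl s t hst ?_
        · rw [corner_succ (n + 2), ← h]
        · rw [h]
          rfl
      · exact ratio_eq_ratioDel_of_ne (by omega) hij hlj' hx'
    · exact ratio_succ_eq_ratioDel (by omega) hij hlj hx

theorem ratio_lacunary_opposite {i j k : Fin 3} (hij : i ≠ j) (hik : i ≠ k) (hjk : j ≠ k) (n : ℕ) :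
    ratio (n + 2) i (lacunary j i k (n + 1)) = 5 / 12 ∧
      ratioDel (n + 2) i j (lacunary j i k (n + 1)) = 5 / 18 := by
  induction n generalizing i k with
  | zero =>
    rw [lacunary, ratio_succ_across le_rfl hij hik hjk (lacunary_mem_verts _ _ _ 0),
      ratioDel_succ_across_self le_rfl hij hik hjk (lacunary_mem_verts _ _ _ 0), lacunary,
      add_comm (corner 0 i) (corner 0 k), ratio, ratioDel, ratioDelPair, ratioDel,
      (count_one_singleton hjk.symm hik.symm hij.symm).2.2.2.1,
      (count_one_empty hik.symm hjk.symm hij).2.2.1,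
      (count_one_pair hik.symm hjk.symm hij).2.2.1,
      (count_one_singleton hik.symm hjk.symm hij).2.2.1, cornerCount_one, cornerCountDel_one]
    norm_num
  | succ n ih =>
    have h := ratio_add_corner_add_corner (n := n + 1) (by omega) hij hik hjk
      (lacunary_mem_verts j i k n)
    have ih' := ih hjk.symm hik.symm hij.symm
    rw [lacunary_comm] at ih'
    exact ⟨h.1.trans ih'.1, h.2.trans ih'.2⟩

theorem ratio_lacunary_adjacent {i j k : Fin 3} (hij : i ≠ j) (hik : i ≠ k) (hjk : j ≠ k) (n : ℕ) :
    (Even n → ratio (n + 2) i (lacunary j j k (n + 1)) = 5 / 12 ∧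
      ratioDel (n + 2) i j (lacunary j j k (n + 1)) = 5 / 18 ∧
      ratio (n + 2) i (lacunary j j i (n + 1)) = 1 / 6 ∧
      ratioDel (n + 2) i j (lacunary j j i (n + 1)) = 7 / 18) ∧
    (Odd n → ratio (n + 2) i (lacunary j j i (n + 1)) = 5 / 12 ∧
      ratioDel (n + 2) i j (lacunary j j i (n + 1)) = 5 / 18 ∧
      ratio (n + 2) i (lacunary j j k (n + 1)) = 1 / 6 ∧
      ratioDel (n + 2) i j (lacunary j j k (n + 1)) = 7 / 18) := by
  induction n generalizing i k with
  | zero =>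
    refine ⟨fun _ => ?_, fun h => by simp at h⟩
    have hl : ∀ s t, lacunary j s t (0 + 1) = corner 0 s + corner 0 t + corner 1 j :=
      fun _ _ => rfl
    have hk : corner 0 j + corner 0 k ∈ verts 1 := lacunary_mem_verts j j k 0
    have hi : corner 0 j + corner 0 i ∈ verts 1 := lacunary_mem_verts j j i 0
    rw [hl, hl, ratio_succ_across le_rfl hij hik hjk hk,
      ratioDel_succ_across_self le_rfl hij hik hjk hk, ratio_succ_across le_rfl hij hik hjk hi,
      ratioDel_succ_across_self le_rfl hij hik hjk hi,
      add_comm (corner 0 j) (corner 0 k), add_comm (corner 0 j) (corner 0 i)]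
    simp only [ratio, ratioDel, ratioDelPair]
    have h1 := count_one_singleton hjk.symm hik.symm hij.symm
    have h2 := count_one_empty hik.symm hjk.symm hij
    have h3 := count_one_pair hik.symm hjk.symm hij
    have h4 := count_one_singleton hik.symm hjk.symm hij
    have h5 := count_one_empty hjk.symm hik.symm hij.symm
    have h6 := count_one_pair hjk.symm hik.symm hij.symm
    rw [add_comm (corner 0 j) (corner 0 i)] at h1 h5 h6
    rw [Set.pair_comm] at h6
    rw [h1.2.2.1, h5.2.2.1, h6.2.2.1, h4.2.2.2.1, h1.2.2.2.2.1, h2.2.2.2, h3.2.2.2,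
      h4.2.2.2.2.1, cornerCount_one, cornerCountDel_one]
    norm_num
  | succ n ih =>
    have hi := ratio_add_corner_add_corner (n := n + 1) (by omega) hij hik hjk
      (lacunary_mem_verts j j i n)
    have hk := ratio_add_corner_add_corner (n := n + 1) (by omega) hij hik hjk
      (lacunary_mem_verts j j k n)
    obtain ⟨ih1, ih2⟩ := ih hjk.symm hik.symm hij.symm
    rw [Nat.even_add_one, Nat.odd_add_one, Nat.not_even_iff_odd, Nat.not_odd_iff_even]
    refine ⟨fun h => ?_, fun h => ?_⟩
    · obtain ⟨h1, h2, h3, h4⟩ := ih2 h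
      exact ⟨hk.1.trans h1, hk.2.trans h2, hi.1.trans h3, hi.2.trans h4⟩
    · obtain ⟨h1, h2, h3, h4⟩ := ih1 h
      exact ⟨hi.1.trans h1, hi.2.trans h2, hk.1.trans h3, hk.2.trans h4⟩

end Lattice

section Plane

theorem card_walks_eq_hamCount {α : Type*} (H : SimpleGraph α) (S : Set α) (u v : α) :
    Nat.card {p : H.Walk u v // p.IsPath ∧ ∀ x, x ∈ p.support ↔ x ∈ S} = hamCount H.Adj S u v := by
  rw [hamCount, ← Nat.card_coe_set_eq]
  refine Nat.card_congr (Equiv.ofBijective (fun p => ⟨p.1.support, p.2.1.support_nodup,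
    p.1.isChain_adj_support, ?_, ?_, p.2.2⟩) ⟨?_, ?_⟩)
  · rw [List.head?_eq_some_head p.1.support_ne_nil, p.1.head_support]
  · rw [List.getLast?_eq_some_getLast p.1.support_ne_nil, p.1.getLast_support]
  · intro p q h
    exact Subtype.ext (SimpleGraph.Walk.ext_support (congrArg Subtype.val h))
  · rintro ⟨l, h1, h2, h3, h4, h5⟩
    have hne : l ≠ [] := by
      rintro rfl
      simp at h3
    obtain rfl : l.head hne = u := by
      rwa [List.head?_eq_some_head hne, Option.some_inj] at h3
    obtain rfl : l.getLast hne = v := by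
      rwa [List.getLast?_eq_some_getLast hne, Option.some_inj] at h4
    refine ⟨⟨SimpleGraph.Walk.ofSupport l hne h2, ?_, ?_⟩, ?_⟩
    · rw [SimpleGraph.Walk.isPath_def, SimpleGraph.Walk.support_ofSupport]
      exact h1
    · rw [SimpleGraph.Walk.support_ofSupport]
      exact h5
    · simp

/-- The point of the plane with the given lattice coordinates. -/
def toPlane (x : ℕ × ℕ) : ℝ × ℝ := (x.1 + x.2 / 2, x.2 / 2 * sq3)

theorem sq3_pos : 0 < sq3 := Real.sqrt_pos.2 (by norm_num)

theorem toPlane_add (x y : ℕ × ℕ) : toPlane (x + y) = toPlane x + toPlane y := by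
  ext <;> simp [toPlane] <;> ring

theorem toPlane_injective : Function.Injective toPlane := by
  rintro ⟨x1, x2⟩ ⟨y1, y2⟩ h
  obtain ⟨h1, h2⟩ := Prod.ext_iff.1 h
  have h2 : (x2 : ℝ) = y2 := by
    have := mul_right_cancel₀ sq3_pos.ne' h2
    simp only at this
    linarith
  have h1 : (x1 : ℝ) = y1 := by
    simp only [toPlane] at h1
    linarith
  exact Prod.ext (Nat.cast_injective h1) (Nat.cast_injective h2)

theorem toPlane_corner (n : ℕ) :
    toPlane (corner n 0) = o ∧ toPlane (corner n 1) = a n ∧ toPlane (corner n 2) = b n := by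
  simp [toPlane, corner, o, a, b]

theorem V_eq_image : ∀ n, V n = toPlane '' verts n
  | 0 => by
    obtain ⟨h0, h1, h2⟩ := toPlane_corner 0
    rw [V, verts, ← h0, ← h1, ← h2]
    ext x
    simp [eq_comm, or_comm, Fin.exists_fin_succ]
  | n + 1 => by
    obtain ⟨h0, h1, h2⟩ := toPlane_corner n
    have hV := V_eq_image n
    rw [V, hV, ← h1, ← h2]
    ext x
    constructor
    · rintro ((⟨y, hy, rfl⟩ | ⟨_, ⟨y, hy, rfl⟩, rfl⟩) | ⟨_, ⟨y, hy, rfl⟩, rfl⟩)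
      · exact ⟨y, ⟨0, y, hy, by simp [corner]⟩, rfl⟩
      · exact ⟨_, ⟨1, y, hy, rfl⟩, toPlane_add _ _⟩
      · exact ⟨_, ⟨2, y, hy, rfl⟩, toPlane_add _ _⟩
    · rintro ⟨_, ⟨i, y, hy, rfl⟩, rfl⟩
      rw [toPlane_add]
      fin_cases i
      · exact .inl (.inl ⟨y, hy, by simp [h0, o]⟩)
      · exact .inl (.inr ⟨_, ⟨y, hy, rfl⟩, rfl⟩)
      · exact .inr ⟨_, ⟨y, hy, rfl⟩, rfl⟩

theorem mem_E_iff : ∀ {n : ℕ} {e : Sym2 (ℝ × ℝ)},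
    e ∈ E n ↔ ∃ x y, edge n x y ∧ e = s(toPlane x, toPlane y)
  | 0, e => by
    obtain ⟨h0, h1, h2⟩ := toPlane_corner 0
    rw [E, ← h0, ← h1, ← h2]
    constructor
    · rintro (rfl | rfl | rfl)
      exacts [⟨_, _, ⟨0, 1, by decide, rfl, rfl⟩, rfl⟩, ⟨_, _, ⟨0, 2, by decide, rfl, rfl⟩, rfl⟩,
        ⟨_, _, ⟨1, 2, by decide, rfl, rfl⟩, rfl⟩]
    · rintro ⟨_, _, ⟨i, j, hij, rfl, rfl⟩, rfl⟩
      fin_cases i <;> fin_cases j <;> simp at hij ⊢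
  | n + 1, e => by
    obtain ⟨h0, h1, h2⟩ := toPlane_corner n
    rw [E, ← h1, ← h2]
    constructor
    · rintro ((h | ⟨d, h, rfl⟩) | ⟨d, h, rfl⟩) <;>
        obtain ⟨x, y, hxy, rfl⟩ := mem_E_iff.1 h
      · exact ⟨x, y, ⟨0, x, y, hxy, by simp [corner], by simp [corner]⟩, rfl⟩
      · exact ⟨_, _, ⟨1, x, y, hxy, rfl, rfl⟩, by simp [toPlane_add]⟩
      · exact ⟨_, _, ⟨2, x, y, hxy, rfl, rfl⟩, by simp [toPlane_add]⟩
    · rintro ⟨_, _, ⟨i, x, y, hxy, rfl, rfl⟩, rfl⟩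
      have h : s(toPlane x, toPlane y) ∈ E n := mem_E_iff.2 ⟨x, y, hxy, rfl⟩
      rw [toPlane_add, toPlane_add]
      fin_cases i
      · exact .inl (.inl (by simpa [show toPlane (corner n 0) = 0 from h0] using h))
      · exact .inl (.inr ⟨_, h, rfl⟩)
      · exact .inr ⟨_, h, rfl⟩

theorem G_adj_toPlane {n : ℕ} {x y : ℕ × ℕ} : (G n).Adj (toPlane x) (toPlane y) ↔ edge n x y := by
  rw [G, SimpleGraph.fromEdgeSet_adj, mem_E_iff]
  constructor
  · rintro ⟨⟨x', y', h, he⟩, -⟩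
    rcases Sym2.eq_iff.1 he with ⟨hx, hy⟩ | ⟨hx, hy⟩
    · rwa [toPlane_injective hx, toPlane_injective hy]
    · rw [toPlane_injective hx, toPlane_injective hy]
      exact edge_symm h
  · exact fun h => ⟨⟨x, y, h, rfl⟩, toPlane_injective.ne (edge_ne h)⟩

theorem f_toPlane (n : ℕ) (x : ℕ × ℕ) : f n o (toPlane x) = count n ∅ 0 x := by
  rw [f, count, vertsDel_empty, ← hamCount_image (adj' := (G n).Adj) toPlane_injective
    fun _ _ _ _ => G_adj_toPlane, ← V_eq_image, (toPlane_corner n).1]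
  exact card_walks_eq_hamCount (G n) (V n) o (toPlane x)

theorem g2_toPlane (n : ℕ) (x : ℕ × ℕ) : g2 n (toPlane x) = count n {2} 0 x := by
  rw [count, ← hamCount_image (adj' := (G n).Adj) toPlane_injective
    fun _ _ _ _ => G_adj_toPlane, (toPlane_corner n).1, vertsDel, Set.image_singleton,
    Set.image_sdiff toPlane_injective, ← V_eq_image, Set.image_singleton, (toPlane_corner n).2.2]
  have h := card_walks_eq_hamCount (Gd n) (V n \ {b n}) o (toPlane x)
  rw [hamCount_congr (adj' := (G n).Adj)] at h
  · exact h
  · rintro y ⟨-, hy⟩ z ⟨-, hz⟩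
    rw [Gd, G, SimpleGraph.fromEdgeSet_adj, SimpleGraph.fromEdgeSet_adj]
    simp only [Set.mem_singleton_iff] at hy hz
    simp [Ne.symm hy, Ne.symm hz]

theorem F_toPlane (n : ℕ) (x : ℕ × ℕ) : F n (toPlane x) = ratio n 0 x := by
  rw [F, f1, ← (toPlane_corner n).2.1, f_toPlane, f_toPlane]
  rfl

theorem G2_toPlane (n : ℕ) (x : ℕ × ℕ) : G2 n (toPlane x) = ratioDel n 0 2 x := by
  rw [G2, g1, ← (toPlane_corner n).2.1, g2_toPlane, g2_toPlane]
  rfl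

theorem toPlane_lacunary (s t : Fin 3) (n : ℕ) :
    toPlane (lacunary 2 s t n) =
      toPlane (corner 0 s) + toPlane (corner 0 t) + ((2 : ℝ) ^ n - 1, ((2 : ℝ) ^ n - 1) * sq3) := by
  induction n with
  | zero => simp [lacunary, toPlane_add]
  | succ n ih =>
    rw [lacunary, toPlane_add, ih, (toPlane_corner _).2.2, b]
    ext <;> simp only [Prod.fst_add, Prod.snd_add, pow_succ] <;> ring

theorem toPlane_lacunary_eq (n : ℕ) : toPlane (lacunary 2 0 1 (n + 1)) = astar (n + 2) ∧
    toPlane (lacunary 2 2 0 (n + 1)) = bstar (n + 2) ∧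
    toPlane (lacunary 2 2 1 (n + 1)) = cstar (n + 2) := by
  obtain ⟨h0, h1, h2⟩ := toPlane_corner 0
  rw [toPlane_lacunary, toPlane_lacunary, toPlane_lacunary, h0, h1, h2, astar, bstar, cstar, o, a,
    b]
  refine ⟨?_, ?_, ?_⟩ <;> ext <;>
    simp only [Prod.fst_add, Prod.snd_add, pow_succ, pow_zero] <;> ring

end Plane

/-- `F` and `G2` agree at almost all vertices; values at the
three exceptional vertices. -/
theorem F_eq_G2_almost_everywhere : ∀ n : ℕ, 2 ≤ n →
    (∀ x ∈ V n, x ≠ o → x ≠ a n → x ≠ b n →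
      x ≠ astar n → x ≠ bstar n → x ≠ cstar n → F n x = G2 n x) ∧
    (F n (astar n) = 5 / 12 ∧ G2 n (astar n) = 5 / 18) ∧
    (Odd n → F n (bstar n) = 5 / 12 ∧ G2 n (bstar n) = 5 / 18 ∧
      F n (cstar n) = 1 / 6 ∧ G2 n (cstar n) = 7 / 18) ∧
    (Even n → F n (bstar n) = 1 / 6 ∧ G2 n (bstar n) = 7 / 18 ∧
      F n (cstar n) = 5 / 12 ∧ G2 n (cstar n) = 5 / 18) := by
  intro n hn
  obtain ⟨n, rfl⟩ := Nat.exists_eq_add_of_le' hn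
  obtain ⟨ha, hb, hc⟩ := toPlane_lacunary_eq n
  have h01 : (0 : Fin 3) ≠ 1 := by decide
  have h02 : (0 : Fin 3) ≠ 2 := by decide
  have h21 : (2 : Fin 3) ≠ 1 := by decide
  have hopp := ratio_lacunary_opposite h02 h01 h21 n
  obtain ⟨heven, hodd⟩ := ratio_lacunary_adjacent h02 h01 h21 n
  refine ⟨?_, ?_, ?_, ?_⟩
  · intro x hx _ _ hxb hxa hxb' hxc
    rw [V_eq_image] at hx
    obtain ⟨x, hx, rfl⟩ := hx
    rw [F_toPlane, G2_toPlane]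
    refine ratio_eq_ratioDel h02 n hx ?_ fun s t hst => ?_
    · rintro rfl
      exact hxb (toPlane_corner _).2.2
    · rintro rfl
      fin_cases s <;> fin_cases t
      exacts [hst rfl, hxa ha, hxb' (lacunary_comm 2 0 2 _ ▸ hb), hxa (lacunary_comm 2 1 0 _ ▸ ha),
        hst rfl, hxc (lacunary_comm 2 1 2 _ ▸ hc), hxb' hb, hxc hc, hst rfl]
  · rwa [← ha, F_toPlane, G2_toPlane]
  · rw [← hb, ← hc, F_toPlane, G2_toPlane, F_toPlane, G2_toPlane]
    exact fun h => hodd (by simpa [parity_simps] using h)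
  · rw [← hb, ← hc, F_toPlane, G2_toPlane, F_toPlane, G2_toPlane]
    intro h
    obtain ⟨h1, h2, h3, h4⟩ := heven (by simpa [parity_simps] using h)
    exact ⟨h3, h4, h1, h2⟩

end SierpinskiGasket
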